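/- (Corollary 4 of the paper, in coordinates.) Let U ⊆ ℝⁿ (n ≥ 2) be open and connected, and let (g, ω) and (ḡ, ω̄) be Randers data on U which are pointwise projectively related, i.e. every forward Randers geodesic of (g, ω) is either a forward Randers geodesic of (ḡ, ω̄) or a forward Randers geodesic of (ḡ, −ω̄). Assume in addition that the set U⁰ := { p ∈ U : (dω)_p ≠ 0 } is nonempty and connected. Then there exists a real constant c > 0 such that at least one of the following holds at all points of U: (1) ḡ = c²·g on U and the 1-form ω̄ − c·ω is closed on U; or (2) ḡ = c²·g on U and the 1-form ω̄ + c·ω is closed on U. -/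

import Mathlib

open Matrix

/-- The partial derivative `∂f/∂x^k` of a scalar function on `ℝⁿ` at a point `p`. -/
noncomputable def dpart {n : ℕ} (f : (Fin n → ℝ) → ℝ) (k : Fin n) (p : Fin n → ℝ) : ℝ :=
  fderiv ℝ f p (Pi.single k 1)

/-- The differential `dω` of a 1-form `ω` (given by its components), as a
skew-symmetric-matrix-valued map: `(dω)_{ik} = ∂ω_i/∂x^k − ∂ω_k/∂x^i`. -/
noncomputable def dform {n : ℕ} (ω : (Fin n → ℝ) → (Fin n → ℝ)) (p : Fin n → ℝ) :
    Matrix (Fin n) (Fin n) ℝ :=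
  Matrix.of fun i k => dpart (fun q => ω q i) k p - dpart (fun q => ω q k) i p

/-- The 1-form `ω` is closed on `U`. -/
def IsClosedFormOn {n : ℕ} (U : Set (Fin n → ℝ)) (ω : (Fin n → ℝ) → (Fin n → ℝ)) : Prop :=
  ∀ p ∈ U, dform ω p = 0

/-- `(g, ω)` is a Randers datum on `U`: `g` is a `C²` field of symmetric positive-definite
matrices and `ω` is a `C²` field of components of a 1-form. -/
def IsRandersDatum {n : ℕ} (U : Set (Fin n → ℝ))
    (g : (Fin n → ℝ) → Matrix (Fin n) (Fin n) ℝ)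
    (ω : (Fin n → ℝ) → (Fin n → ℝ)) : Prop :=
  (∀ p ∈ U, (g p).IsSymm ∧ (g p).PosDef) ∧
  (∀ i j, ContDiffOn ℝ 2 (fun q => g q i j) U) ∧
  (∀ i, ContDiffOn ℝ 2 (fun q => ω q i) U)

/-- `x : I → U` is a forward Randers geodesic of `(g, ω)`: `I` is an open interval, `x` is a
`C²` curve in `U` with nowhere-vanishing derivative satisfying the Euler–Lagrange equation of
the Randers length functional. -/
def IsRandersGeodesic {n : ℕ} (U : Set (Fin n → ℝ))
    (g : (Fin n → ℝ) → Matrix (Fin n) (Fin n) ℝ)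
    (ω : (Fin n → ℝ) → (Fin n → ℝ))
    (I : Set ℝ) (x : ℝ → (Fin n → ℝ)) : Prop :=
  IsOpen I ∧ I.OrdConnected ∧ (∀ t ∈ I, x t ∈ U) ∧
  ContDiffOn ℝ 2 x I ∧ (∀ t ∈ I, deriv x t ≠ 0) ∧
  ∀ t ∈ I, ∀ j : Fin n,
    deriv (deriv x) t j / Real.sqrt (∑ k, ∑ m, g (x t) k m * deriv x t k * deriv x t m)
    + deriv x t j *
        deriv (fun s => 1 / Real.sqrt (∑ k, ∑ m, g (x s) k m * deriv x s k * deriv x s m)) t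
    + (1 / Real.sqrt (∑ k, ∑ m, g (x t) k m * deriv x t k * deriv x t m)) *
        ∑ i, ∑ k, ∑ p, (g (x t))⁻¹ j i * dpart (fun q => g q i p) k (x t) *
          deriv x t k * deriv x t p
    + ∑ i, ∑ k, (g (x t))⁻¹ j i *
        (dpart (fun q => ω q i) k (x t) - dpart (fun q => ω q k) i (x t)) * deriv x t k
    - (1 / (2 * Real.sqrt (∑ k, ∑ m, g (x t) k m * deriv x t k * deriv x t m))) *
        ∑ i, ∑ p, ∑ q, (g (x t))⁻¹ j i * dpart (fun r => g r p q) i (x t) *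
          deriv x t p * deriv x t q
    = 0

open Polynomial in
/-- If `g P² = h Q²` with `h` prime and `P ≠ 0`, then `h` divides `g`. -/
theorem prime_dvd_of_mul_sq_eq_mul_sq {g h P Q : ℝ[X]} (hh : Prime h) (hP : P ≠ 0)
    (H : g * P ^ 2 = h * Q ^ 2) : h ∣ g := by
  by_cases hg : g = 0
  · simp [hg]
  have hQ : Q ≠ 0 := by
    rintro rfl
    simp [hg, hP] at H
  by_contra hdvd
  have h1 := congrArg (emultiplicity h) H
  have fP : FiniteMultiplicity h P := FiniteMultiplicity.of_prime_left hh hP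
  have fQ : FiniteMultiplicity h Q := FiniteMultiplicity.of_prime_left hh hQ
  have fh : emultiplicity h h = 1 := by
    simpa using emultiplicity_pow_self_of_prime hh 1
  rw [emultiplicity_mul hh, emultiplicity_mul hh, emultiplicity_pow hh, emultiplicity_pow hh,
    emultiplicity_eq_zero.2 hdvd, fh, fP.emultiplicity_eq_multiplicity,
    fQ.emultiplicity_eq_multiplicity] at h1
  norm_cast at h1
  omega

/-- The coordinates of the bivector `x ∧ v`. -/
def wedge {n : ℕ} (x v : Fin n → ℝ) (i j : Fin n) : ℝ := x i * v j - x j * v i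

theorem wedge_smul_self {n : ℕ} (c : ℝ) (v : Fin n → ℝ) (i j : Fin n) :
    wedge (c • v) v i j = 0 := by
  simp [wedge]; ring

theorem exists_smul_of_wedge_eq_zero {n : ℕ} {x v : Fin n → ℝ} (hv : v ≠ 0)
    (h : ∀ i j, wedge x v i j = 0) : ∃ c : ℝ, x = c • v := by
  obtain ⟨k, hk⟩ := Function.ne_iff.1 hv
  refine ⟨x k / v k, funext fun i => ?_⟩
  have := h i k
  simp only [wedge, Pi.zero_apply] at this hk
  simp only [Pi.smul_apply, smul_eq_mul]
  field_simp
  linarith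

/-- In dimension at least two, every nonzero vector lies on a line avoiding the origin. -/
theorem exists_line_avoiding_zero {n : ℕ} (hn : 2 ≤ n) {a : Fin n → ℝ} (ha : a ≠ 0) :
    ∃ b : Fin n → ℝ, b ≠ 0 ∧ ∀ t : ℝ, a + t • b ≠ 0 := by
  obtain ⟨k, hk⟩ := Function.ne_iff.1 ha
  have : Nontrivial (Fin n) := Fin.nontrivial_iff_two_le.2 hn
  obtain ⟨l, hl⟩ := exists_ne k
  refine ⟨Pi.single l 1, ?_, fun t h => ?_⟩
  · simp
  · have := congrFun h k
    simp [hl.symm] at this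
    exact hk this

/-- The restriction of `f` to the line `t ↦ a + t b` is polynomial. -/
def IsPolyOnLine {n : ℕ} (a b : Fin n → ℝ) (f : (Fin n → ℝ) → ℝ) : Prop :=
  ∃ P : Polynomial ℝ, ∀ t : ℝ, f (a + t • b) = P.eval t

namespace IsPolyOnLine

variable {n : ℕ} {a b : Fin n → ℝ} {f h : (Fin n → ℝ) → ℝ}

theorem mul (hf : IsPolyOnLine a b f) (hh : IsPolyOnLine a b h) :
    IsPolyOnLine a b (fun v => f v * h v) := by
  obtain ⟨P, hP⟩ := hf
  obtain ⟨Q, hQ⟩ := hh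
  exact ⟨P * Q, fun t => by simp [hP, hQ]⟩

theorem sub (hf : IsPolyOnLine a b f) (hh : IsPolyOnLine a b h) :
    IsPolyOnLine a b (fun v => f v - h v) := by
  obtain ⟨P, hP⟩ := hf
  obtain ⟨Q, hQ⟩ := hh
  exact ⟨P - Q, fun t => by simp [hP, hQ]⟩

theorem linear (l : (Fin n → ℝ) →ₗ[ℝ] (Fin n → ℝ)) (i : Fin n) :
    IsPolyOnLine a b (fun v => l v i) :=
  ⟨Polynomial.C (l a i) + Polynomial.X * Polynomial.C (l b i), fun t => by simp; ring⟩

theorem wedge (F : (Fin n → ℝ) → (Fin n → ℝ)) (hF : ∀ i, IsPolyOnLine a b (fun v => F v i))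
    (i j : Fin n) : IsPolyOnLine a b (fun v => wedge (F v) v i j) :=
  ((hF i).mul (linear LinearMap.id j)).sub ((hF j).mul (linear LinearMap.id i))

theorem bilinear (B : (Fin n → ℝ) →ₗ[ℝ] (Fin n → ℝ) →ₗ[ℝ] (Fin n → ℝ)) (i : Fin n) :
    IsPolyOnLine a b (fun v => B v v i) :=
  ⟨Polynomial.C (B a a i) + Polynomial.X * Polynomial.C (B a b i + B b a i)
    + Polynomial.X ^ 2 * Polynomial.C (B b b i), fun t => by simp; ring⟩

end IsPolyOnLine

theorem Matrix.PosDef.quad_pos {n : ℕ} {G : Matrix (Fin n) (Fin n) ℝ} (hG : G.PosDef)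
    {v : Fin n → ℝ} (hv : v ≠ 0) : 0 < v ⬝ᵥ (G *ᵥ v) := by
  simpa using hG.dotProduct_mulVec_pos hv

theorem Matrix.IsSymm.dotProduct_mulVec_comm {n : ℕ} {G : Matrix (Fin n) (Fin n) ℝ}
    (hG : G.IsSymm) (v w : Fin n → ℝ) : v ⬝ᵥ (G *ᵥ w) = w ⬝ᵥ (G *ᵥ v) := by
  rw [Matrix.dotProduct_mulVec, ← Matrix.mulVec_transpose, hG.eq, dotProduct_comm]

theorem Matrix.PosDef.mulVec_inv {n : ℕ} {G : Matrix (Fin n) (Fin n) ℝ} (hG : G.PosDef)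
    (v : Fin n → ℝ) : G *ᵥ (G⁻¹ *ᵥ v) = v := by
  rw [Matrix.mulVec_mulVec, Matrix.mul_nonsing_inv _ (hG.isUnit.map Matrix.detMonoidHom),
    Matrix.one_mulVec]

/-- The quadratic polynomial `t ↦ G(a + t b, a + t b)`. -/
noncomputable def linePoly {n : ℕ} (G : Matrix (Fin n) (Fin n) ℝ) (a b : Fin n → ℝ) :
    Polynomial ℝ :=
  Polynomial.C (b ⬝ᵥ (G *ᵥ b)) * Polynomial.X ^ 2
    + Polynomial.C (a ⬝ᵥ (G *ᵥ b) + b ⬝ᵥ (G *ᵥ a)) * Polynomial.X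
    + Polynomial.C (a ⬝ᵥ (G *ᵥ a))

theorem eval_linePoly {n : ℕ} (G : Matrix (Fin n) (Fin n) ℝ) (a b : Fin n → ℝ) (t : ℝ) :
    (linePoly G a b).eval t = (a + t • b) ⬝ᵥ (G *ᵥ (a + t • b)) := by
  simp [linePoly, Matrix.mulVec_add, Matrix.mulVec_smul, add_dotProduct, dotProduct_add]
  ring

theorem natDegree_linePoly {n : ℕ} {G : Matrix (Fin n) (Fin n) ℝ} (hG : G.PosDef)
    {a b : Fin n → ℝ} (hb : b ≠ 0) : (linePoly G a b).natDegree = 2 :=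
  Polynomial.natDegree_quadratic (hG.quad_pos hb).ne'

theorem prime_linePoly {n : ℕ} {G : Matrix (Fin n) (Fin n) ℝ} (hG : G.PosDef)
    {a b : Fin n → ℝ} (hb : b ≠ 0) (hab : ∀ t : ℝ, a + t • b ≠ 0) :
    Prime (linePoly G a b) := by
  refine (Polynomial.irreducible_of_degree_le_three_of_not_isRoot ?_ fun t ht => ?_).prime
  · rw [natDegree_linePoly hG hb]; decide
  · rw [Polynomial.IsRoot.def, eval_linePoly] at ht
    exact (hG.quad_pos (hab t)).ne' ht

/-- A polynomial map whose square is a positive-definite quadratic form times a square vanishes. -/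
theorem eq_zero_of_sq_eq_quad_mul_sq {n : ℕ} (hn : 2 ≤ n) {H : Matrix (Fin n) (Fin n) ℝ}
    (hH : H.PosDef) {p q : (Fin n → ℝ) → ℝ} (hp : ∀ a b, IsPolyOnLine a b p)
    (hq : ∀ a b, IsPolyOnLine a b q)
    (h : ∀ v, v ≠ 0 → p v ^ 2 = (v ⬝ᵥ (H *ᵥ v)) * q v ^ 2) {v : Fin n → ℝ} (hv : v ≠ 0) :
    p v = 0 ∧ q v = 0 := by
  obtain ⟨b, hb, hvb⟩ := exists_line_avoiding_zero hn hv
  obtain ⟨P, hP⟩ := hp v b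
  obtain ⟨Q, hQ⟩ := hq v b
  have hprime := prime_linePoly hH hb hvb
  have key : 1 * P ^ 2 = linePoly H v b * Q ^ 2 := by
    refine Polynomial.funext fun t => ?_
    simp [eval_linePoly, ← hP, ← hQ, h _ (hvb t)]
  have hP0 : P = 0 := by
    by_contra hne
    exact hprime.not_isUnit (isUnit_of_dvd_one (prime_dvd_of_mul_sq_eq_mul_sq hprime hne key))
  have h1 : p v = 0 := by simpa [hP0] using hP 0
  refine ⟨h1, ?_⟩
  have h2 := h v hv
  rw [h1] at h2
  have h3 := (hH.quad_pos hv).ne'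
  simpa [h3] using h2.symm

theorem Matrix.IsSymm.eq_of_quad_eq {n : ℕ} {G H : Matrix (Fin n) (Fin n) ℝ} (hG : G.IsSymm)
    (hH : H.IsSymm) (h : ∀ v, v ⬝ᵥ (G *ᵥ v) = v ⬝ᵥ (H *ᵥ v)) : G = H := by
  ext i j
  have h1 := h (Pi.single i 1 + Pi.single j 1)
  have h2 := h (Pi.single i 1)
  have h3 := h (Pi.single j 1)
  have h4 := hG.apply i j
  have h5 := hH.apply i j
  simp [Matrix.mulVec_add, add_dotProduct] at h1 h2 h3
  linarith

/-- Two positive-definite forms with `G p² = H q²` along all vectors, `p` not identically zero,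
are proportional. -/
theorem exists_smul_of_quad_mul_sq_eq {n : ℕ} {G H : Matrix (Fin n) (Fin n) ℝ}
    (hG : G.PosDef) (hH : H.PosDef) (hGs : G.IsSymm) (hHs : H.IsSymm)
    {p q : (Fin n → ℝ) → ℝ} (hp : ∀ a b, IsPolyOnLine a b p)
    (hq : ∀ a b, IsPolyOnLine a b q)
    (h : ∀ v, v ≠ 0 → (v ⬝ᵥ (G *ᵥ v)) * p v ^ 2 = (v ⬝ᵥ (H *ᵥ v)) * q v ^ 2)
    {a : Fin n → ℝ} (ha : a ≠ 0) (hpa : p a ≠ 0) :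
    ∃ κ : ℝ, 0 < κ ∧ H = κ • G := by
  have hGa := hG.quad_pos ha
  have hHa := hH.quad_pos ha
  refine ⟨(a ⬝ᵥ (H *ᵥ a)) / (a ⬝ᵥ (G *ᵥ a)), by positivity, ?_⟩
  refine hHs.eq_of_quad_eq (hGs.smul _) fun b => ?_
  rw [Matrix.smul_mulVec, dotProduct_smul, smul_eq_mul]
  by_cases hb : b = 0
  · simp [hb]
  by_cases hab : ∀ t : ℝ, a + t • b ≠ 0
  · obtain ⟨P, hP⟩ := hp a b
    obtain ⟨Q, hQ⟩ := hq a b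
    have key : linePoly G a b * P ^ 2 = linePoly H a b * Q ^ 2 := by
      refine Polynomial.funext fun t => ?_
      rw [Polynomial.eval_mul, Polynomial.eval_mul, Polynomial.eval_pow, Polynomial.eval_pow,
        eval_linePoly, eval_linePoly, ← hP, ← hQ]
      exact h _ (hab t)
    have hP0 : P ≠ 0 := by
      rintro rfl
      have := hP 0
      simp at this
      exact hpa this
    obtain ⟨R, hR⟩ := prime_dvd_of_mul_sq_eq_mul_sq (prime_linePoly hH hb hab) hP0 key
    have hR0 : R ≠ 0 := by
      rintro rfl
      have := natDegree_linePoly hG (a := a) hb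
      simp [hR] at this
    have hdeg := congrArg Polynomial.natDegree hR
    rw [Polynomial.natDegree_mul (prime_linePoly hH hb hab).ne_zero hR0,
      natDegree_linePoly hG hb, natDegree_linePoly hH hb] at hdeg
    obtain ⟨r, rfl⟩ := Polynomial.natDegree_eq_zero.1 (show R.natDegree = 0 by omega)
    have h0 := congrArg (Polynomial.coeff · 0) hR
    have h2 := congrArg (Polynomial.coeff · 2) hR
    simp [linePoly] at h0 h2
    rw [h2, h0]
    have : r ≠ 0 := by rintro rfl; simp at hR0
    field_simp
  · push Not at hab
    obtain ⟨t, ht⟩ := hab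
    have : a = (-t) • b := by rw [neg_smul]; exact eq_neg_of_add_eq_zero_left ht
    have ht0 : t ≠ 0 := by rintro rfl; simp at this; exact ha this
    have hGb := hG.quad_pos hb
    rw [this]
    simp [Matrix.mulVec_neg, Matrix.mulVec_smul]
    field_simp

/-- The linear map `v ↦ G⁻¹ Ω v`. -/
noncomputable def lorentz {n : ℕ} (G Ω : Matrix (Fin n) (Fin n) ℝ) :
    (Fin n → ℝ) →ₗ[ℝ] (Fin n → ℝ) :=
  (G⁻¹ * Ω).mulVecLin

theorem lorentz_apply {n : ℕ} (G Ω : Matrix (Fin n) (Fin n) ℝ) (v : Fin n → ℝ) :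
    lorentz G Ω v = G⁻¹ *ᵥ (Ω *ᵥ v) := by
  simp [lorentz]

theorem mulVec_lorentz {n : ℕ} {G : Matrix (Fin n) (Fin n) ℝ} (hG : G.PosDef)
    (Ω : Matrix (Fin n) (Fin n) ℝ) (v : Fin n → ℝ) :
    G *ᵥ (lorentz G Ω v) = Ω *ᵥ v := by
  rw [lorentz_apply, hG.mulVec_inv]

theorem dotProduct_mulVec_self_of_skew {n : ℕ} {Ω : Matrix (Fin n) (Fin n) ℝ}
    (hΩ : Ωᵀ = -Ω) (v : Fin n → ℝ) : v ⬝ᵥ (Ω *ᵥ v) = 0 := by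
  have h : v ⬝ᵥ (Ω *ᵥ v) = -(v ⬝ᵥ (Ω *ᵥ v)) := by
    conv_lhs => rw [Matrix.dotProduct_mulVec, ← Matrix.mulVec_transpose, hΩ, dotProduct_comm]
    rw [Matrix.neg_mulVec, dotProduct_neg]
  linarith

/-- The magnetic force `G⁻¹ Ω v` is never a nonzero multiple of `v`. -/
theorem mulVec_eq_zero_of_lorentz_eq_smul {n : ℕ} {G Ω : Matrix (Fin n) (Fin n) ℝ}
    (hG : G.PosDef) (hΩ : Ωᵀ = -Ω) {v : Fin n → ℝ} (hv : v ≠ 0) {μ : ℝ}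
    (h : lorentz G Ω v = μ • v) : Ω *ᵥ v = 0 := by
  have h1 := mulVec_lorentz hG Ω v
  rw [h, Matrix.mulVec_smul] at h1
  have h2 := dotProduct_mulVec_self_of_skew hΩ v
  rw [← h1, dotProduct_smul, smul_eq_mul, mul_eq_zero] at h2
  rcases h2 with rfl | h2
  · rw [← h1, zero_smul]
  · exact absurd h2 (hG.quad_pos hv).ne'

theorem exists_mulVec_ne_zero {n : ℕ} {Ω : Matrix (Fin n) (Fin n) ℝ} (h : Ω ≠ 0) :
    ∃ a, Ω *ᵥ a ≠ 0 := by
  by_contra! H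
  refine h (Matrix.ext fun i j => ?_)
  simpa using congrFun (H (Pi.single j 1)) i

/-- At a single tangent space: `B` is the difference of the Christoffel symbols, `Ω`, `Ω'` are the
values of the differentials of the two 1-forms, and in each direction `v` the accelerations of the
geodesics agree modulo `v`, for one of the two signs of `Ω'`. -/
def SpraysAgree {n : ℕ} (B : (Fin n → ℝ) →ₗ[ℝ] (Fin n → ℝ) →ₗ[ℝ] (Fin n → ℝ))
    (G H Ω Ω' : Matrix (Fin n) (Fin n) ℝ) : Prop :=
  ∀ v, v ≠ 0 → ∃ s : ℝ, (s = 1 ∨ s = -1) ∧ ∃ μ : ℝ,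
    B v v + (s * √(v ⬝ᵥ (H *ᵥ v))) • lorentz H Ω' v
      - √(v ⬝ᵥ (G *ᵥ v)) • lorentz G Ω v = μ • v

namespace SpraysAgree

variable {n : ℕ} {B : (Fin n → ℝ) →ₗ[ℝ] (Fin n → ℝ) →ₗ[ℝ] (Fin n → ℝ)}
  {G H Ω Ω' : Matrix (Fin n) (Fin n) ℝ}

theorem exists_smul_of_mulVec_ne_zero (h : SpraysAgree B G H Ω Ω') (hG : G.PosDef)
    (hΩ : Ωᵀ = -Ω) {v : Fin n → ℝ} (hv : Ω *ᵥ v ≠ 0) : ∃ c : ℝ, B v v = c • v := by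
  have hv0 : v ≠ 0 := by rintro rfl; simp at hv
  obtain ⟨s, hs, μ, h1⟩ := h v hv0
  obtain ⟨s', hs', μ', h2⟩ := h (-v) (neg_ne_zero.2 hv0)
  simp only [map_neg, LinearMap.neg_apply, neg_neg, Matrix.mulVec_neg, dotProduct_neg,
    neg_dotProduct, smul_neg] at h2
  have hN := Real.sqrt_pos.2 (hG.quad_pos hv0)
  set N := √(v ⬝ᵥ (G *ᵥ v))
  set M := √(v ⬝ᵥ (H *ᵥ v))
  by_cases hss : s = s'
  · subst hss
    refine ⟨(μ - μ') / 2, ?_⟩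
    ext i
    have e1 := congrFun h1 i
    have e2 := congrFun h2 i
    simp at e1 e2 ⊢
    linarith
  · have hs2 : s' = -s := by
      rcases hs with rfl | rfl <;> rcases hs' with rfl | rfl <;> simp_all
    subst hs2
    refine absurd (mulVec_eq_zero_of_lorentz_eq_smul hG hΩ hv0
      (μ := -((μ + μ') / (2 * N))) ?_) hv
    ext i
    have e1 := congrFun h1 i
    have e2 := congrFun h2 i
    simp at e1 e2 ⊢
    field_simp
    linarith

/-- If `Ω = 0` then `B v v ∥ v` and `Ω' = 0`. -/
theorem of_form_eq_zero (h : SpraysAgree B G H 0 Ω') (hn : 2 ≤ n) (hH : H.PosDef)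
    (hΩ' : Ω'ᵀ = -Ω') : (∀ v, v ≠ 0 → ∃ c : ℝ, B v v = c • v) ∧ Ω' = 0 := by
  have key : ∀ v, v ≠ 0 → ∀ i j, wedge (B v v) v i j = 0 ∧ wedge (lorentz H Ω' v) v i j = 0 := by
    intro v hv i j
    refine eq_zero_of_sq_eq_quad_mul_sq hn hH (p := fun v => wedge (B v v) v i j)
      (q := fun v => wedge (lorentz H Ω' v) v i j)
      (fun a b => IsPolyOnLine.wedge _ (fun i => IsPolyOnLine.bilinear B i) i j)
      (fun a b => IsPolyOnLine.wedge _ (fun i => IsPolyOnLine.linear _ i) i j) ?_ hv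
    intro v hv
    obtain ⟨s, hs, μ, h1⟩ := h v hv
    have hN := (hH.quad_pos hv).le
    have hM := Real.sq_sqrt hN
    set M := √(v ⬝ᵥ (H *ᵥ v))
    have hw : wedge (B v v) v i j = -(s * M) * wedge (lorentz H Ω' v) v i j := by
      have e1 := congrFun h1 i
      have e2 := congrFun h1 j
      simp [lorentz_apply (G := G)] at e1 e2
      simp only [wedge]
      rw [show B v v i = μ * v i - s * M * lorentz H Ω' v i by linarith,
        show B v v j = μ * v j - s * M * lorentz H Ω' v j by linarith]
      ring
    have hs2 : s ^ 2 = 1 := by rcases hs with rfl | rfl <;> norm_num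
    change wedge (B v v) v i j ^ 2 = _ * wedge (lorentz H Ω' v) v i j ^ 2
    rw [hw, ← hM, mul_pow, neg_sq, mul_pow, hs2, one_mul]
  refine ⟨fun v hv => exists_smul_of_wedge_eq_zero hv fun i j => (key v hv i j).1, ?_⟩
  by_contra hne
  obtain ⟨a, ha⟩ := exists_mulVec_ne_zero hne
  have ha0 : a ≠ 0 := by rintro rfl; simp at ha
  obtain ⟨c, hc⟩ := exists_smul_of_wedge_eq_zero ha0 fun i j => (key a ha0 i j).2
  exact ha (mulVec_eq_zero_of_lorentz_eq_smul hH hΩ' ha0 hc)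

/-- The metrics are projectively equivalent. -/
theorem exists_smul (h : SpraysAgree B G H Ω Ω') (hn : 2 ≤ n) (hG : G.PosDef) (hH : H.PosDef)
    (hΩ : Ωᵀ = -Ω) (hΩ' : Ω'ᵀ = -Ω') {v : Fin n → ℝ} (hv : v ≠ 0) :
    ∃ c : ℝ, B v v = c • v := by
  by_cases h0 : Ω = 0
  · subst h0
    exact (h.of_form_eq_zero hn hH hΩ').1 v hv
  obtain ⟨a, ha⟩ := exists_mulVec_ne_zero h0
  refine exists_smul_of_wedge_eq_zero hv fun i j => ?_
  obtain ⟨P, hP⟩ := IsPolyOnLine.wedge (a := v) (b := a) _ (fun i => IsPolyOnLine.bilinear B i) i j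
  suffices hP0 : P = 0 by simpa [hP0] using hP 0
  have hbad : Set.Subsingleton {t : ℝ | Ω *ᵥ (v + t • a) = 0} := by
    intro t ht t' ht'
    simp only [Set.mem_ofPred_eq, Matrix.mulVec_add, Matrix.mulVec_smul] at ht ht'
    have h3 : (t - t') • (Ω *ᵥ a) = 0 := by
      rw [sub_smul, eq_neg_of_add_eq_zero_right ht, eq_neg_of_add_eq_zero_right ht', sub_self]
    rcases smul_eq_zero.1 h3 with h3 | h3
    · linarith
    · exact absurd h3 ha
  refine Polynomial.eq_zero_of_infinite_isRoot P ?_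
  refine (hbad.finite.infinite_compl).mono fun t ht => ?_
  obtain ⟨c, hc⟩ := h.exists_smul_of_mulVec_ne_zero hG hΩ ht
  simp only [Set.mem_ofPred_eq, Polynomial.IsRoot.def, ← hP, hc, wedge_smul_self]

theorem exists_conformal (h : SpraysAgree B G H Ω Ω') (hn : 2 ≤ n) (hG : G.PosDef)
    (hH : H.PosDef) (hGs : G.IsSymm) (hHs : H.IsSymm)
    (hΩ : Ωᵀ = -Ω) (hΩ' : Ω'ᵀ = -Ω') (h0 : Ω ≠ 0) : ∃ κ : ℝ, 0 < κ ∧ H = κ • G := by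
  obtain ⟨a, ha⟩ := exists_mulVec_ne_zero h0
  have ha0 : a ≠ 0 := by rintro rfl; simp at ha
  have : ∃ i j, wedge (lorentz G Ω a) a i j ≠ 0 := by
    by_contra! hc
    obtain ⟨c, hc⟩ := exists_smul_of_wedge_eq_zero ha0 hc
    exact ha (mulVec_eq_zero_of_lorentz_eq_smul hG hΩ ha0 hc)
  obtain ⟨i, j, hij⟩ := this
  refine exists_smul_of_quad_mul_sq_eq hG hH hGs hHs
      (p := fun v => wedge (lorentz G Ω v) v i j)
      (q := fun v => wedge (lorentz H Ω' v) v i j)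
      (fun a b => IsPolyOnLine.wedge _ (fun i => IsPolyOnLine.linear _ i) i j)
      (fun a b => IsPolyOnLine.wedge _ (fun i => IsPolyOnLine.linear _ i) i j) ?_ ha0 hij
  intro v hv
  obtain ⟨s, hs, μ, h1⟩ := h v hv
  obtain ⟨c, hc⟩ := h.exists_smul hn hG hH hΩ hΩ' hv
  rw [hc] at h1
  have hM := Real.sq_sqrt (hH.quad_pos hv).le
  have hN := Real.sq_sqrt (hG.quad_pos hv).le
  set M := √(v ⬝ᵥ (H *ᵥ v))
  set N := √(v ⬝ᵥ (G *ᵥ v))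
  have hw : N * wedge (lorentz G Ω v) v i j = s * M * wedge (lorentz H Ω' v) v i j := by
    have e1 := congrFun h1 i
    have e2 := congrFun h1 j
    simp at e1 e2
    simp only [wedge]
    linear_combination (-v j) * e1 + v i * e2
  have hs2 : s ^ 2 = 1 := by rcases hs with rfl | rfl <;> norm_num
  change _ * wedge (lorentz G Ω v) v i j ^ 2 = _ * wedge (lorentz H Ω' v) v i j ^ 2
  rw [← hM, ← hN, ← mul_pow, hw, mul_pow, mul_pow, hs2, one_mul]

theorem form_eq_or_neg {c : ℝ} (hc : 0 < c) (h : SpraysAgree B G (c ^ 2 • G) Ω Ω') (hn : 2 ≤ n)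
    (hG : G.PosDef) (hΩ : Ωᵀ = -Ω) (hΩ' : Ω'ᵀ = -Ω') : Ω' = c • Ω ∨ Ω' = -(c • Ω) := by
  have hH : (c ^ 2 • G).PosDef := hG.smul (by positivity)
  have key : ∀ v, Ω' *ᵥ v = c • (Ω *ᵥ v) ∨ Ω' *ᵥ v = -(c • (Ω *ᵥ v)) := by
    intro v
    by_cases hv : v = 0
    · simp [hv]
    obtain ⟨s, hs, μ, h1⟩ := h v hv
    obtain ⟨r, hr⟩ := h.exists_smul hn hG hH hΩ hΩ' hv
    have hN := Real.sqrt_pos.2 (hG.quad_pos hv)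
    have hM : √(v ⬝ᵥ ((c ^ 2 • G) *ᵥ v)) = c * √(v ⬝ᵥ (G *ᵥ v)) := by
      rw [Matrix.smul_mulVec, dotProduct_smul, smul_eq_mul, Real.sqrt_mul (by positivity),
        Real.sqrt_sq hc.le]
    have h2 : (c ^ 2) • G *ᵥ (lorentz (c ^ 2 • G) Ω' v) = Ω' *ᵥ v := by
      rw [← Matrix.smul_mulVec, mulVec_lorentz hH]
    have h3 := mulVec_lorentz hG Ω v
    rw [hr, hM] at h1
    set N := √(v ⬝ᵥ (G *ᵥ v))
    have h4 := congrArg (fun x => (c ^ 2) • (G *ᵥ x)) h1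
    simp only [Matrix.mulVec_add, Matrix.mulVec_sub, Matrix.mulVec_smul, h3, smul_add, smul_sub]
      at h4
    rw [smul_comm (c ^ 2) (s * (c * N)), h2] at h4
    have h5 := congrArg (fun x => v ⬝ᵥ x) h4
    simp only [dotProduct_add, dotProduct_sub, dotProduct_smul,
      dotProduct_mulVec_self_of_skew hΩ, dotProduct_mulVec_self_of_skew hΩ', smul_eq_mul] at h5
    have hq := hG.quad_pos hv
    have hμ : r = μ := by
      have : c ^ 2 * (v ⬝ᵥ (G *ᵥ v)) * (r - μ) = 0 := by linarith
      have hne : c ^ 2 * (v ⬝ᵥ (G *ᵥ v)) ≠ 0 := by positivity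
      have := (mul_eq_zero.1 this).resolve_left hne
      linarith
    subst hμ
    have h6 : ∀ i, s * (Ω' *ᵥ v) i = c * (Ω *ᵥ v) i := by
      intro i
      have e := congrFun h4 i
      simp at e
      have : (c * N) * (s * (Ω' *ᵥ v) i - c * (Ω *ᵥ v) i) = 0 := by linarith
      have hne : c * N ≠ 0 := by positivity
      have := (mul_eq_zero.1 this).resolve_left hne
      linarith
    rcases hs with rfl | rfl
    · left; ext i; simpa using h6 i
    · right; ext i; have := h6 i; simp at this ⊢; linarith
  by_contra! hcon
  obtain ⟨a, ha⟩ := exists_mulVec_ne_zero (sub_ne_zero.2 hcon.1)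
  obtain ⟨b, hb⟩ := exists_mulVec_ne_zero (sub_ne_zero.2 hcon.2)
  simp only [Matrix.sub_mulVec, Matrix.neg_mulVec, Matrix.smul_mulVec, ne_eq, sub_eq_zero] at ha hb
  have ka := (key a).resolve_left ha
  have kb := (key b).resolve_right hb
  have kab := key (a + b)
  simp only [Matrix.mulVec_add, ka, kb] at kab
  rcases kab with kab | kab
  · refine ha (ka.trans ?_)
    ext i
    have e := congrFun kab i
    simp at e ⊢
    linarith
  · refine hb (kb.trans ?_)
    ext i
    have e := congrFun kab i
    simp at e ⊢
    linarith

end SpraysAgree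

/-- Contracting the difference of two Christoffel symbols with the same unparametrized
geodesics. -/
theorem trace_of_forall_exists_smul {n : ℕ}
    {B : (Fin n → ℝ) →ₗ[ℝ] (Fin n → ℝ) →ₗ[ℝ] (Fin n → ℝ)} (hsymm : ∀ v w, B v w = B w v)
    (h : ∀ v, v ≠ 0 → ∃ c : ℝ, B v v = c • v) {v : Fin n → ℝ} (hv : v ≠ 0) {c : ℝ}
    (hc : B v v = c • v) : 2 * ∑ k, B v (Pi.single k 1) k = (n + 1) * c := by
  have hw : ∀ v i j, wedge (B v v) v i j = 0 := by
    intro v i j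
    by_cases hv : v = 0
    · simp [hv, wedge]
    obtain ⟨c, hc⟩ := h v hv
    rw [hc, wedge_smul_self]
  have pol : ∀ w i j, wedge (2 • B v w - c • w) v i j = 0 := by
    intro w i j
    have h1 := hw (v + w) i j
    have h2 := hw (v - w) i j
    have h3 := hw w i j
    have ei := congrFun hc i
    have ej := congrFun hc j
    simp [wedge, hsymm w v] at h1 h2 h3 ei ej ⊢
    rw [ei, ej] at h1 h2
    linear_combination (1 / 2) * h1 + (-1 / 2) * h2 - h3
  obtain ⟨k, hk⟩ := Function.ne_iff.1 hv
  simp only [Pi.zero_apply, ne_eq] at hk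
  have e : ∀ i, 2 * B v (Pi.single i 1) i = c + (2 * B v (Pi.single i 1) k
      - c * (Pi.single i 1 : Fin n → ℝ) k) * v i / v k := by
    intro i
    have := pol (Pi.single i 1) i k
    simp [wedge] at this
    field_simp
    linarith
  rw [Finset.mul_sum, Finset.sum_congr rfl fun i _ => e i, Finset.sum_add_distrib,
    ← Finset.sum_div]
  have s1 : ∑ i, (2 * B v (Pi.single i 1) k - c * (Pi.single i 1 : Fin n → ℝ) k) * v i
      = 2 * B v v k - c * v k := by
    have : v = ∑ i, v i • (Pi.single i 1 : Fin n → ℝ) := by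
      ext j; simp [Finset.sum_apply, Pi.single_apply]
    have h1 : B v v k = ∑ i, v i * B v (Pi.single i 1) k := by
      have e := congrArg (fun w => B v w k) this
      simpa using e
    have h2 : v k = ∑ i, v i * (Pi.single i 1 : Fin n → ℝ) k := by
      simp [Pi.single_apply]
    rw [h1]
    conv_rhs => rw [h2]
    rw [Finset.mul_sum, Finset.mul_sum, ← Finset.sum_sub_distrib]
    exact Finset.sum_congr rfl fun i _ => by ring
  rw [s1, hc]
  simp
  field_simp
  ring

/-- The directional derivative of a matrix field, entrywise. -/
noncomputable def matDeriv {n : ℕ} (g : (Fin n → ℝ) → Matrix (Fin n) (Fin n) ℝ)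
    (p v : Fin n → ℝ) : Matrix (Fin n) (Fin n) ℝ :=
  Matrix.of fun i j => fderiv ℝ (fun q => g q i j) p v

section matDeriv

variable {n : ℕ} (g : (Fin n → ℝ) → Matrix (Fin n) (Fin n) ℝ) (p : Fin n → ℝ)

theorem matDeriv_add (v w : Fin n → ℝ) :
    matDeriv g p (v + w) = matDeriv g p v + matDeriv g p w := by
  ext i j; simp [matDeriv]

theorem matDeriv_smul (c : ℝ) (v : Fin n → ℝ) : matDeriv g p (c • v) = c • matDeriv g p v := by
  ext i j; simp [matDeriv]

theorem sum_dpart_mul (f : (Fin n → ℝ) → ℝ) (v : Fin n → ℝ) :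
    ∑ k, dpart f k p * v k = fderiv ℝ f p v := by
  have : v = ∑ i, v i • (Pi.single i 1 : Fin n → ℝ) := by
    ext j; simp [Finset.sum_apply, Pi.single_apply]
  have e := congrArg (fderiv ℝ f p) this
  simp only [map_sum, map_smul, smul_eq_mul] at e
  rw [e]
  exact Finset.sum_congr rfl fun i _ => mul_comm _ _

theorem matDeriv_apply_eq_sum (v : Fin n → ℝ) (i j : Fin n) :
    matDeriv g p v i j = ∑ k, matDeriv g p (Pi.single k 1) i j * v k :=
  (sum_dpart_mul p (fun q => g q i j) v).symm

/-- The covector-valued Christoffel symbols of the first kind. -/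
noncomputable def christoffelLower (v w : Fin n → ℝ) : Fin n → ℝ := fun i =>
  ((matDeriv g p v *ᵥ w) i + (matDeriv g p w *ᵥ v) i
    - v ⬝ᵥ (matDeriv g p (Pi.single i 1) *ᵥ w)) / 2

/-- The Christoffel symbols `Γ(v, w)` of the metric `g` at `p`. -/
noncomputable def christoffel : (Fin n → ℝ) →ₗ[ℝ] (Fin n → ℝ) →ₗ[ℝ] (Fin n → ℝ) :=
  LinearMap.mk₂ ℝ (fun v w => (g p)⁻¹ *ᵥ christoffelLower g p v w)
    (fun v v' w => by
      rw [← Matrix.mulVec_add]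
      congr 1
      ext i
      simp [christoffelLower, matDeriv_add, Matrix.add_mulVec, Matrix.mulVec_add, add_dotProduct]
      ring)
    (fun c v w => by
      rw [← Matrix.mulVec_smul]
      congr 1
      ext i
      simp [christoffelLower, matDeriv_smul, Matrix.smul_mulVec, Matrix.mulVec_smul]
      ring)
    (fun v w w' => by
      rw [← Matrix.mulVec_add]
      congr 1
      ext i
      simp [christoffelLower, matDeriv_add, Matrix.add_mulVec, Matrix.mulVec_add, dotProduct_add]
      ring)
    (fun c v w => by
      rw [← Matrix.mulVec_smul]
      congr 1
      ext i
      simp [christoffelLower, matDeriv_smul, Matrix.smul_mulVec, Matrix.mulVec_smul]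
      ring)

theorem christoffel_apply (v w : Fin n → ℝ) :
    christoffel g p v w = (g p)⁻¹ *ᵥ christoffelLower g p v w := rfl

variable {g p}

theorem christoffel_comm (hs : ∀ v, (matDeriv g p v).IsSymm) (v w : Fin n → ℝ) :
    christoffel g p v w = christoffel g p w v := by
  rw [christoffel_apply, christoffel_apply]
  congr 1
  ext i
  simp only [christoffelLower, (hs (Pi.single i 1)).dotProduct_mulVec_comm v w]
  ring

theorem dotProduct_mulVec_christoffel (hG : (g p).PosDef) (v : Fin n → ℝ) :
    v ⬝ᵥ (g p *ᵥ christoffel g p v v) = v ⬝ᵥ (matDeriv g p v *ᵥ v) / 2 := by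
  rw [christoffel_apply, hG.mulVec_inv]
  have h : v ⬝ᵥ (matDeriv g p v *ᵥ v)
      = ∑ i, v i * (v ⬝ᵥ (matDeriv g p (Pi.single i 1) *ᵥ v)) := by
    have e : matDeriv g p v = ∑ i, v i • matDeriv g p (Pi.single i 1) := by
      ext j k
      rw [matDeriv_apply_eq_sum, Matrix.sum_apply]
      exact Finset.sum_congr rfl fun i _ => by simp [mul_comm]
    rw [e, Matrix.sum_mulVec, dotProduct_sum]
    simp only [Matrix.smul_mulVec, dotProduct_smul, smul_eq_mul]
  have h2 : v ⬝ᵥ christoffelLower g p v v = (2 * (v ⬝ᵥ (matDeriv g p v *ᵥ v))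
      - ∑ i, v i * (v ⬝ᵥ (matDeriv g p (Pi.single i 1) *ᵥ v))) / 2 := by
    simp only [dotProduct, christoffelLower]
    rw [Finset.mul_sum, ← Finset.sum_sub_distrib, Finset.sum_div]
    exact Finset.sum_congr rfl fun i _ => by ring
  rw [h2, ← h]
  ring

theorem two_mul_sum_christoffel (hGs : (g p).IsSymm) (hs : ∀ v, (matDeriv g p v).IsSymm)
    (v : Fin n → ℝ) :
    2 * ∑ k, christoffel g p v (Pi.single k 1) k = ((g p)⁻¹ * matDeriv g p v).trace := by
  have hinv : ((g p)⁻¹).IsSymm := by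
    rw [Matrix.IsSymm, Matrix.transpose_nonsing_inv, hGs.eq]
  have e : ∀ k, 2 * christoffel g p v (Pi.single k 1) k
      = ((g p)⁻¹ * matDeriv g p v) k k
        + (∑ i, (g p)⁻¹ k i * (matDeriv g p (Pi.single k 1) *ᵥ v) i
          - ∑ i, (g p)⁻¹ k i * (matDeriv g p (Pi.single i 1) *ᵥ v) k) := by
    intro k
    rw [christoffel_apply, Matrix.mul_apply, Matrix.mulVec, dotProduct, Finset.mul_sum,
      ← Finset.sum_sub_distrib, ← Finset.sum_add_distrib]
    refine Finset.sum_congr rfl fun i _ => ?_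
    simp only [christoffelLower]
    rw [(hs _).dotProduct_mulVec_comm v]
    simp
    ring
  rw [Finset.mul_sum, Finset.sum_congr rfl fun k _ => e k, Finset.sum_add_distrib,
    Finset.sum_sub_distrib]
  rw [show (∑ k, ∑ i, (g p)⁻¹ k i * (matDeriv g p (Pi.single i 1) *ᵥ v) k)
      = ∑ k, ∑ i, (g p)⁻¹ k i * (matDeriv g p (Pi.single k 1) *ᵥ v) i from ?_]
  · simp [Matrix.trace]
  · rw [Finset.sum_comm]
    refine Finset.sum_congr rfl fun k _ => Finset.sum_congr rfl fun i _ => ?_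
    rw [hinv.apply]

end matDeriv

/-- The Euler–Lagrange expression of a Randers datum in terms of Christoffel symbols and the
magnetic force. -/
theorem eulerLagrange_eq {n : ℕ} (g : (Fin n → ℝ) → Matrix (Fin n) (Fin n) ℝ)
    (ω : (Fin n → ℝ) → (Fin n → ℝ)) (p v : Fin n → ℝ) (j : Fin n) (A r : ℝ) :
    A + (1 / r) * ∑ i, ∑ k, ∑ m, (g p)⁻¹ j i * dpart (fun q => g q i m) k p * v k * v m
    + ∑ i, ∑ k, (g p)⁻¹ j i * (dpart (fun q => ω q i) k p - dpart (fun q => ω q k) i p) * v k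
    - (1 / (2 * r)) * ∑ i, ∑ m, ∑ q, (g p)⁻¹ j i * dpart (fun r => g r m q) i p * v m * v q
    = A + (1 / r) * christoffel g p v v j + lorentz (g p) (dform ω p) v j := by
  have h1 : ∑ i, ∑ k, ∑ m, (g p)⁻¹ j i * dpart (fun q => g q i m) k p * v k * v m
      = ∑ i, (g p)⁻¹ j i * (matDeriv g p v *ᵥ v) i := by
    refine Finset.sum_congr rfl fun i _ => ?_
    simp only [Matrix.mulVec, dotProduct]
    rw [Finset.sum_comm, Finset.mul_sum]
    refine Finset.sum_congr rfl fun m _ => ?_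
    rw [matDeriv, Matrix.of_apply, ← sum_dpart_mul, Finset.sum_mul, Finset.mul_sum]
    exact Finset.sum_congr rfl fun k _ => by ring
  have h2 : ∑ i, ∑ k, (g p)⁻¹ j i * (dpart (fun q => ω q i) k p - dpart (fun q => ω q k) i p) * v k
      = lorentz (g p) (dform ω p) v j := by
    rw [lorentz_apply, Matrix.mulVec, dotProduct]
    refine Finset.sum_congr rfl fun i _ => ?_
    rw [Matrix.mulVec, dotProduct, Finset.mul_sum]
    exact Finset.sum_congr rfl fun k _ => by simp [dform]; ring
  have h3 : ∑ i, ∑ m, ∑ q, (g p)⁻¹ j i * dpart (fun r => g r m q) i p * v m * v q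
      = ∑ i, (g p)⁻¹ j i * (v ⬝ᵥ (matDeriv g p (Pi.single i 1) *ᵥ v)) := by
    refine Finset.sum_congr rfl fun i _ => ?_
    simp only [Matrix.mulVec, dotProduct]
    rw [Finset.mul_sum]
    refine Finset.sum_congr rfl fun m _ => ?_
    rw [Finset.mul_sum, Finset.mul_sum]
    refine Finset.sum_congr rfl fun q _ => ?_
    simp only [matDeriv, dpart, Matrix.of_apply]
    ring
  have h4 : christoffel g p v v j = ∑ i, (g p)⁻¹ j i * (matDeriv g p v *ᵥ v) i
      - (∑ i, (g p)⁻¹ j i * (v ⬝ᵥ (matDeriv g p (Pi.single i 1) *ᵥ v))) / 2 := by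
    rw [christoffel_apply, Matrix.mulVec, dotProduct, Finset.sum_div, ← Finset.sum_sub_distrib]
    refine Finset.sum_congr rfl fun i _ => ?_
    simp only [christoffelLower]
    ring
  rw [h1, h2, h3, h4, one_div, one_div, mul_inv]
  ring

theorem quad_eq_sum {n : ℕ} (G : Matrix (Fin n) (Fin n) ℝ) (v : Fin n → ℝ) :
    ∑ k, ∑ m, G k m * v k * v m = v ⬝ᵥ (G *ᵥ v) := by
  simp only [dotProduct, Matrix.mulVec, Finset.mul_sum]
  exact Finset.sum_congr rfl fun k _ => Finset.sum_congr rfl fun m _ => by ring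

theorem contDiff_det (n : ℕ) {k : WithTop ℕ∞} :
    ContDiff ℝ k (fun M : Fin n → Fin n → ℝ => (Matrix.of M).det) := by
  simp only [Matrix.det_apply, Matrix.of_apply]
  fun_prop

/-- Jacobi's formula. -/
theorem HasDerivAt.matrix_det {n : ℕ} {M : ℝ → Matrix (Fin n) (Fin n) ℝ}
    {M' : Matrix (Fin n) (Fin n) ℝ} {t : ℝ}
    (h : ∀ i j, HasDerivAt (fun s => M s i j) (M' i j) t) (hM : IsUnit (M t).det) :
    HasDerivAt (fun s => (M s).det) ((M t).det * ((M t)⁻¹ * M').trace) t := by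
  set F : (Fin n → Fin n → ℝ) → ℝ := fun M => (Matrix.of M).det with hF
  have hd : DifferentiableAt ℝ F (1 : Matrix (Fin n) (Fin n) ℝ) :=
    (contDiff_det n (k := 1)).differentiable one_ne_zero _
  have key : ∀ N : Matrix (Fin n) (Fin n) ℝ,
      fderiv ℝ F (1 : Matrix (Fin n) (Fin n) ℝ) N = N.trace := by
    intro N
    have h1 : HasDerivAt (fun r : ℝ => (fun i j => (1 : Matrix (Fin n) (Fin n) ℝ) i j + r * N i j :
        Fin n → Fin n → ℝ)) (fun i j => N i j) 0 :=
      hasDerivAt_pi.2 fun i => hasDerivAt_pi.2 fun j => by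
        exact (hasDerivAt_mul_const (N i j)).const_add ((1 : Matrix (Fin n) (Fin n) ℝ) i j)
    have h2 : HasDerivAt (fun r : ℝ => (1 + r • N).det) (fderiv ℝ F
        (1 : Matrix (Fin n) (Fin n) ℝ) N) 0 := by
      have hd' : HasFDerivAt F (fderiv ℝ F (1 : Matrix (Fin n) (Fin n) ℝ))
          ((fun i j => (1 : Matrix (Fin n) (Fin n) ℝ) i j + (0 : ℝ) * N i j :
        Fin n → Fin n → ℝ)) := by
        have e : (fun i j => (1 : Matrix (Fin n) (Fin n) ℝ) i j + (0 : ℝ) * N i j)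
            = (1 : Matrix (Fin n) (Fin n) ℝ) := by ext i j; simp
        rw [e]
        exact hd.hasFDerivAt
      exact hd'.comp_hasDerivAt (0 : ℝ) h1
    have h3 : HasDerivAt (fun r : ℝ => (1 + r • N).det) N.trace 0 := by
      rw [funext fun r : ℝ => Matrix.det_one_add_smul r N]
      set Q := (Matrix.det (1 + (Polynomial.X : Polynomial ℝ) • N.map Polynomial.C)).divX.divX
      have := (((hasDerivAt_id (0 : ℝ)).const_mul N.trace).const_add 1).add
        ((Q.hasDerivAt 0).mul ((hasDerivAt_id (0 : ℝ)).pow 2))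
      exact this.congr_deriv (by simp)
    exact h2.unique h3
  have hK : HasDerivAt (fun s => (fun i j => ((M t)⁻¹ * M s) i j : Fin n → Fin n → ℝ))
      (fun i j => ((M t)⁻¹ * M') i j) t := by
    refine hasDerivAt_pi.2 fun i => hasDerivAt_pi.2 fun j => ?_
    simp only [Matrix.mul_apply]
    exact HasDerivAt.fun_sum fun k _ => (h k j).const_mul _
  have hd' : HasFDerivAt F (fderiv ℝ F (1 : Matrix (Fin n) (Fin n) ℝ))
      (fun i j => ((M t)⁻¹ * M t) i j : Fin n → Fin n → ℝ) := by
    rw [Matrix.nonsing_inv_mul _ hM]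
    exact hd.hasFDerivAt
  have h5 := (hd'.comp_hasDerivAt t hK).const_mul (M t).det
  have h6 : fderiv ℝ F (1 : Matrix (Fin n) (Fin n) ℝ) (fun i j => ((M t)⁻¹ * M') i j)
      = ((M t)⁻¹ * M').trace := key _
  rw [h6] at h5
  refine h5.congr_of_eventuallyEq (Filter.Eventually.of_forall fun s => ?_)
  change (M s).det = (M t).det * ((M t)⁻¹ * M s).det
  rw [← Matrix.det_mul, Matrix.mul_nonsing_inv_cancel_left _ _ hM]

theorem dform_transpose {n : ℕ} (ω : (Fin n → ℝ) → (Fin n → ℝ)) (p : Fin n → ℝ) :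
    (dform ω p)ᵀ = -dform ω p := by
  ext i j
  simp [dform]

theorem dform_neg {n : ℕ} (ω : (Fin n → ℝ) → (Fin n → ℝ)) (p : Fin n → ℝ) :
    dform (fun q => -ω q) p = -dform ω p := by
  ext i j
  simp only [dform, dpart, Matrix.of_apply, Matrix.neg_apply, Pi.neg_apply, fderiv_fun_neg,
    _root_.neg_apply]
  ring

theorem dform_zero {n : ℕ} (p : Fin n → ℝ) : dform (fun _ : Fin n → ℝ => (0 : Fin n → ℝ)) p = 0 := by
  ext i j
  simp [dform, dpart]

/-- The acceleration of the constant-speed Randers geodesics of `(g, ω)` as a function of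
position and velocity. -/
noncomputable def spray {n : ℕ} (g : (Fin n → ℝ) → Matrix (Fin n) (Fin n) ℝ)
    (ω : (Fin n → ℝ) → (Fin n → ℝ)) (p v : Fin n → ℝ) : Fin n → ℝ :=
  -christoffel g p v v - √(v ⬝ᵥ (g p *ᵥ v)) • lorentz (g p) (dform ω p) v

namespace IsRandersDatum

variable {n : ℕ} {U : Set (Fin n → ℝ)} {g : (Fin n → ℝ) → Matrix (Fin n) (Fin n) ℝ}
  {ω : (Fin n → ℝ) → (Fin n → ℝ)}

theorem zero_form (h : IsRandersDatum U g ω) : IsRandersDatum U g (fun _ => 0) :=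
  ⟨h.1, h.2.1, fun _ => contDiffOn_const⟩

theorem posDef (h : IsRandersDatum U g ω) {p : Fin n → ℝ} (hp : p ∈ U) : (g p).PosDef :=
  (h.1 p hp).2

theorem isSymm (h : IsRandersDatum U g ω) {p : Fin n → ℝ} (hp : p ∈ U) : (g p).IsSymm :=
  (h.1 p hp).1

theorem contDiffAt_metric (h : IsRandersDatum U g ω) (hU : IsOpen U) {p : Fin n → ℝ}
    (hp : p ∈ U) (i j : Fin n) : ContDiffAt ℝ 2 (fun q => g q i j) p :=
  (h.2.1 i j).contDiffAt (hU.mem_nhds hp)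

theorem contDiffAt_form (h : IsRandersDatum U g ω) (hU : IsOpen U) {p : Fin n → ℝ}
    (hp : p ∈ U) (i : Fin n) : ContDiffAt ℝ 2 (fun q => ω q i) p :=
  (h.2.2 i).contDiffAt (hU.mem_nhds hp)

theorem matDeriv_isSymm (h : IsRandersDatum U g ω) (hU : IsOpen U) {p : Fin n → ℝ}
    (hp : p ∈ U) (v : Fin n → ℝ) : (matDeriv g p v).IsSymm := by
  refine Matrix.IsSymm.ext fun i j => ?_
  have : (fun q => g q j i) =ᶠ[nhds p] fun q => g q i j := by
    filter_upwards [hU.mem_nhds hp] with q hq using (h.isSymm hq).apply i j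
  simp only [matDeriv, Matrix.of_apply, this.fderiv_eq]

theorem hasDerivAt_metric (h : IsRandersDatum U g ω) (hU : IsOpen U) {x : ℝ → Fin n → ℝ}
    {v : Fin n → ℝ} {t : ℝ} (hx : HasDerivAt x v t) (ht : x t ∈ U) (i j : Fin n) :
    HasDerivAt (fun s => g (x s) i j) (matDeriv g (x t) v i j) t :=
  ((h.contDiffAt_metric hU ht i j).differentiableAt two_ne_zero).hasFDerivAt.comp_hasDerivAt t hx

theorem hasDerivAt_quad (h : IsRandersDatum U g ω) (hU : IsOpen U) {x v : ℝ → Fin n → ℝ}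
    {a : Fin n → ℝ} {t : ℝ} (hx : HasDerivAt x (v t) t) (hv : HasDerivAt v a t) (ht : x t ∈ U) :
    HasDerivAt (fun s => v s ⬝ᵥ (g (x s) *ᵥ v s))
      (2 * (v t ⬝ᵥ (g (x t) *ᵥ a)) + v t ⬝ᵥ (matDeriv g (x t) (v t) *ᵥ v t)) t := by
  have hv' := hasDerivAt_pi.1 hv
  have key : HasDerivAt (fun s => v s ⬝ᵥ (g (x s) *ᵥ v s))
      (∑ i, (a i * (g (x t) *ᵥ v t) i + v t i * ∑ j, (matDeriv g (x t) (v t) i j * v t j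
        + g (x t) i j * a j))) t := by
    simp only [dotProduct, Matrix.mulVec]
    exact HasDerivAt.fun_sum fun i _ => (hv' i).mul
      (HasDerivAt.fun_sum fun j _ => (h.hasDerivAt_metric hU hx ht i j).mul (hv' j))
  refine key.congr_deriv ?_
  have e : ∀ i, a i * (g (x t) *ᵥ v t) i + v t i * ∑ j, (matDeriv g (x t) (v t) i j * v t j
        + g (x t) i j * a j) = a i * (g (x t) *ᵥ v t) i
        + v t i * (matDeriv g (x t) (v t) *ᵥ v t) i + v t i * (g (x t) *ᵥ a) i := by
    intro i
    rw [Finset.sum_add_distrib]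
    simp only [dotProduct, Matrix.mulVec]
    ring
  rw [Finset.sum_congr rfl fun i _ => e i, Finset.sum_add_distrib, Finset.sum_add_distrib]
  change a ⬝ᵥ (g (x t) *ᵥ v t) + _ ⬝ᵥ _ + _ ⬝ᵥ _ = _
  rw [(h.isSymm ht).dotProduct_mulVec_comm a]
  ring

theorem hasDerivAt_log_det (h : IsRandersDatum U g ω) (hU : IsOpen U) {x : ℝ → Fin n → ℝ}
    {v : Fin n → ℝ} {t : ℝ} (hx : HasDerivAt x v t) (ht : x t ∈ U) :
    HasDerivAt (fun s => Real.log (g (x s)).det) (((g (x t))⁻¹ * matDeriv g (x t) v).trace) t := by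
  have hd : (g (x t)).det ≠ 0 := (h.posDef ht).det_pos.ne'
  refine ((HasDerivAt.matrix_det (M := fun s => g (x s)) (h.hasDerivAt_metric hU hx ht)
    hd.isUnit).log hd).congr_deriv ?_
  rw [mul_div_cancel_left₀ _ hd]

theorem two_mul_quad_spray (h : IsRandersDatum U g ω) {p : Fin n → ℝ} (hp : p ∈ U)
    (v : Fin n → ℝ) :
    2 * (v ⬝ᵥ (g p *ᵥ spray g ω p v)) + v ⬝ᵥ (matDeriv g p v *ᵥ v) = 0 := by
  rw [spray, Matrix.mulVec_sub, Matrix.mulVec_neg, Matrix.mulVec_smul, mulVec_lorentz (h.posDef hp),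
    dotProduct_sub, dotProduct_neg, dotProduct_smul,
    dotProduct_mulVec_self_of_skew (dform_transpose ω p),
    dotProduct_mulVec_christoffel (h.posDef hp)]
  simp
  ring

theorem contDiffAt_matDeriv (h : IsRandersDatum U g ω) (hU : IsOpen U) {z : (Fin n → ℝ) × (Fin n → ℝ)}
    (hz : z.1 ∈ U) {w : (Fin n → ℝ) × (Fin n → ℝ) → Fin n → ℝ} (hw : ContDiffAt ℝ 1 w z) (i j : Fin n) :
    ContDiffAt ℝ 1 (fun y : (Fin n → ℝ) × (Fin n → ℝ) => matDeriv g y.1 (w y) i j) z := by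
  have h1 : ContDiffAt ℝ 1 (fderiv ℝ fun q => g q i j) z.1 :=
    (h.contDiffAt_metric hU hz i j).fderiv_right (m := 1) (by norm_num)
  exact (h1.comp z contDiffAt_fst).clm_apply hw

theorem contDiffAt_dform (h : IsRandersDatum U g ω) (hU : IsOpen U) {p : Fin n → ℝ}
    (hp : p ∈ U) (i j : Fin n) :
    ContDiffAt ℝ 1 (fun q => dform ω q i j) p := by
  have h1 : ∀ i, ContDiffAt ℝ 1 (fderiv ℝ fun q => ω q i) p := fun i =>
    (h.contDiffAt_form hU hp i).fderiv_right (m := 1) (by norm_num)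
  exact ((h1 i).clm_apply contDiffAt_const).sub ((h1 j).clm_apply contDiffAt_const)

theorem contDiffAt_inv (h : IsRandersDatum U g ω) (hU : IsOpen U) {p : Fin n → ℝ}
    (hp : p ∈ U) (i j : Fin n) :
    ContDiffAt ℝ 1 (fun q => (g q)⁻¹ i j) p := by
  have hg : ∀ i j, ContDiffAt ℝ 1 (fun q => g q i j) p := fun i j =>
    (h.contDiffAt_metric hU hp i j).of_le (by norm_num)
  have hdet : ∀ M : (Fin n → ℝ) → Matrix (Fin n) (Fin n) ℝ,
      (∀ i j, ContDiffAt ℝ 1 (fun q => M q i j) p) → ContDiffAt ℝ 1 (fun q => (M q).det) p :=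
    fun M hM => (contDiff_det n).contDiffAt.comp (f := fun q => (fun i j => M q i j)) p
      (contDiffAt_pi.2 fun i => contDiffAt_pi.2 fun j => hM i j)
  simp only [Matrix.inv_def, Matrix.smul_apply, Matrix.adjugate_apply, Ring.inverse_eq_inv',
    smul_eq_mul]
  refine ((hdet _ hg).inv (h.posDef hp).det_pos.ne').mul (hdet _ fun k l => ?_)
  simp only [Matrix.updateRow_apply]
  split_ifs
  · exact contDiffAt_const
  · exact hg k l

theorem contDiffAt_mulVec {F : Type*} [NormedAddCommGroup F] [NormedSpace ℝ F]
    {M : F → Matrix (Fin n) (Fin n) ℝ} {w : F → Fin n → ℝ} {z : F}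
    (hM : ∀ i j, ContDiffAt ℝ 1 (fun y => M y i j) z) (hw : ContDiffAt ℝ 1 w z) :
    ContDiffAt ℝ 1 (fun y => M y *ᵥ w y) z := by
  refine contDiffAt_pi.2 fun i => ?_
  simp only [Matrix.mulVec, dotProduct]
  exact ContDiffAt.sum fun j _ => (hM i j).mul (contDiffAt_pi.1 hw j)

theorem contDiffAt_dotProduct {F : Type*} [NormedAddCommGroup F] [NormedSpace ℝ F]
    {v w : F → Fin n → ℝ} {z : F}
    (hv : ContDiffAt ℝ 1 v z) (hw : ContDiffAt ℝ 1 w z) :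
    ContDiffAt ℝ 1 (fun y => v y ⬝ᵥ w y) z := by
  simp only [dotProduct]
  exact ContDiffAt.sum fun j _ => (contDiffAt_pi.1 hv j).mul (contDiffAt_pi.1 hw j)

theorem contDiffAt_spray (h : IsRandersDatum U g ω) (hU : IsOpen U)
    {z : (Fin n → ℝ) × (Fin n → ℝ)} (hz : z.1 ∈ U) (hz2 : z.2 ≠ 0) :
    ContDiffAt ℝ 1 (fun y : (Fin n → ℝ) × (Fin n → ℝ) => spray g ω y.1 y.2) z := by
  have hg : ∀ i j, ContDiffAt ℝ 1 (fun y : (Fin n → ℝ) × (Fin n → ℝ) => g y.1 i j) z := fun i j =>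
    ((h.contDiffAt_metric hU hz i j).of_le (by norm_num)).comp z contDiffAt_fst
  have hi : ∀ i j, ContDiffAt ℝ 1 (fun y : (Fin n → ℝ) × (Fin n → ℝ) => (g y.1)⁻¹ i j) z :=
    fun i j => (h.contDiffAt_inv hU hz i j).comp z contDiffAt_fst
  have hd : ∀ i j, ContDiffAt ℝ 1 (fun y : (Fin n → ℝ) × (Fin n → ℝ) => dform ω y.1 i j) z :=
    fun i j => (h.contDiffAt_dform hU hz i j).comp z contDiffAt_fst
  have hs : ContDiffAt ℝ 1 (fun y : (Fin n → ℝ) × (Fin n → ℝ) => y.2) z := contDiffAt_snd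
  simp only [spray, christoffel_apply, lorentz_apply]
  refine (contDiffAt_mulVec hi ?_).neg.sub (ContDiffAt.fun_smul ?_ ?_)
  · refine contDiffAt_pi.2 fun i => ?_
    simp only [christoffelLower]
    have h1 := contDiffAt_mulVec (h.contDiffAt_matDeriv hU hz hs) hs
    have h2 := contDiffAt_dotProduct hs (contDiffAt_mulVec (h.contDiffAt_matDeriv hU hz
      (contDiffAt_const (c := (Pi.single i 1 : Fin n → ℝ)))) hs)
    exact (((contDiffAt_pi.1 h1 i).add (contDiffAt_pi.1 h1 i)).sub h2).div_const 2
  · exact (contDiffAt_dotProduct hs (contDiffAt_mulVec hg hs)).sqrt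
      ((h.posDef hz).quad_pos hz2).ne'
  · exact contDiffAt_mulVec hi (contDiffAt_mulVec hd hs)

end IsRandersDatum

/-- A `C¹` vector field has a continuous local flow staying in a given neighbourhood. -/
theorem ContDiffAt.exists_local_flow {E : Type*} [NormedAddCommGroup E] [NormedSpace ℝ E]
    [CompleteSpace E] {f : E → E} {z₀ : E} (hf : ContDiffAt ℝ 1 f z₀) {V : Set E}
    (hV : V ∈ nhds z₀) :
    ∃ r > 0, ∃ ε > 0, ∃ α : E × ℝ → E,
      (∀ z ∈ Metric.ball z₀ r, α (z, 0) = z ∧ ∀ t ∈ Set.Ioo (-ε) ε,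
        α (z, t) ∈ V ∧ HasDerivAt (fun s => α (z, s)) (f (α (z, t))) t) ∧
      ContinuousOn α (Metric.ball z₀ r ×ˢ Set.Ioo (-ε) ε) := by
  obtain ⟨ε, hε, a, r, L, K, hr, hpl⟩ := IsPicardLindelof.of_contDiffAt_one hf
  obtain ⟨α, hα, hαc⟩ :=
    (hpl 0).exists_forall_mem_closedBall_eq_hasDerivWithinAt_continuousOn
  have hr' : (0 : ℝ) < r := hr
  have hnhds : Metric.closedBall z₀ r ×ˢ Set.Icc ((0 : ℝ) - ε) (0 + ε) ∈ nhds (z₀, (0 : ℝ)) :=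
    prod_mem_nhds (Metric.closedBall_mem_nhds _ hr') (Icc_mem_nhds (by linarith) (by linarith))
  have hc0 : ContinuousAt α (z₀, 0) := hαc.continuousAt hnhds
  have hz0 : α (z₀, 0) = z₀ := (hα z₀ (Metric.mem_closedBall_self hr'.le)).1
  have hpre : α ⁻¹' V ∈ nhds (z₀, (0 : ℝ)) := hc0 (by rwa [hz0])
  obtain ⟨A, hA, B, hB, hAB⟩ := mem_nhds_prod_iff.1 hpre
  obtain ⟨r', hr'0, hr'A⟩ := Metric.mem_nhds_iff.1 hA
  obtain ⟨ε', hε'0, hε'B⟩ := Metric.mem_nhds_iff.1 hB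
  have hI : ∀ t ∈ Set.Ioo (-(min ε ε')) (min ε ε'), t ∈ Set.Ioo ((0 : ℝ) - ε) (0 + ε) := by
    intro t ht
    have := min_le_left ε ε'
    constructor <;> linarith [ht.1, ht.2]
  have hBall : Metric.ball z₀ (min r r') ⊆ Metric.closedBall z₀ r :=
    (Metric.ball_subset_ball (min_le_left _ _)).trans Metric.ball_subset_closedBall
  refine ⟨min r r', lt_min hr' hr'0, min ε ε', lt_min hε hε'0, α, fun z hz => ⟨(hα z (hBall hz)).1,
    fun t ht => ⟨hAB ⟨hr'A (Metric.ball_subset_ball (min_le_right _ _) hz), hε'B ?_⟩, ?_⟩⟩, ?_⟩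
  · rw [Metric.mem_ball, Real.dist_eq, sub_zero, abs_lt]
    have := min_le_right ε ε'
    constructor <;> linarith [ht.1, ht.2]
  · exact ((hα z (hBall hz)).2 t (Set.Ioo_subset_Icc_self (hI t ht))).hasDerivAt
      (Icc_mem_nhds (hI t ht).1 (hI t ht).2)
  · exact hαc.mono (Set.prod_mono hBall fun t ht => Set.Ioo_subset_Icc_self (hI t ht))

/-- The second-order flow of the spray of a Randers datum. -/
theorem IsRandersDatum.exists_spray_flow {n : ℕ} {U : Set (Fin n → ℝ)}
    {g : (Fin n → ℝ) → Matrix (Fin n) (Fin n) ℝ} {ω : (Fin n → ℝ) → (Fin n → ℝ)}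
    (h : IsRandersDatum U g ω) (hU : IsOpen U) {p v : Fin n → ℝ} (hp : p ∈ U) (hv : v ≠ 0) :
    ∃ r > 0, ∃ ε > 0, ∃ α : ((Fin n → ℝ) × (Fin n → ℝ)) × ℝ → (Fin n → ℝ) × (Fin n → ℝ),
      (∀ z ∈ Metric.ball (p, v) r, α (z, 0) = z ∧ ∀ t ∈ Set.Ioo (-ε) ε,
        (α (z, t)).1 ∈ U ∧ (α (z, t)).2 ≠ 0 ∧
        HasDerivAt (fun s => (α (z, s)).1) (α (z, t)).2 t ∧
        HasDerivAt (fun s => (α (z, s)).2) (spray g ω (α (z, t)).1 (α (z, t)).2) t) ∧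
      ContinuousOn α (Metric.ball (p, v) r ×ˢ Set.Ioo (-ε) ε) := by
  have hf : ContDiffAt ℝ 1 (fun y : (Fin n → ℝ) × (Fin n → ℝ) => (y.2, spray g ω y.1 y.2))
      (p, v) := contDiffAt_snd.prodMk (h.contDiffAt_spray hU hp hv)
  have hV : U ×ˢ {w : Fin n → ℝ | w ≠ 0} ∈ nhds (p, v) :=
    prod_mem_nhds (hU.mem_nhds hp) (isOpen_ne.mem_nhds hv)
  obtain ⟨r, hr, ε, hε, α, hα, hc⟩ := hf.exists_local_flow hV
  refine ⟨r, hr, ε, hε, α, fun z hz => ⟨(hα z hz).1, fun t ht => ?_⟩, hc⟩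
  obtain ⟨hm, hd⟩ := (hα z hz).2 t ht
  exact ⟨hm.1, hm.2, hd.fst, hd.snd⟩

/-- Solutions of the second-order equation of the spray have constant speed. -/
theorem IsRandersDatum.hasDerivAt_quad_of_spray {n : ℕ} {U : Set (Fin n → ℝ)}
    {g : (Fin n → ℝ) → Matrix (Fin n) (Fin n) ℝ} {ω : (Fin n → ℝ) → (Fin n → ℝ)}
    (h : IsRandersDatum U g ω) (hU : IsOpen U) {x v : ℝ → Fin n → ℝ} {t : ℝ} (ht : x t ∈ U)
    (hx : HasDerivAt x (v t) t) (hv : HasDerivAt v (spray g ω (x t) (v t)) t) :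
    HasDerivAt (fun s => v s ⬝ᵥ (g (x s) *ᵥ v s)) 0 t :=
  (h.hasDerivAt_quad hU hx hv ht).congr_deriv (h.two_mul_quad_spray ht (v t))

/-- Through every point and in every direction there is a Randers geodesic whose acceleration is
given by the spray. -/
theorem IsRandersDatum.exists_geodesic {n : ℕ} {U : Set (Fin n → ℝ)}
    {g : (Fin n → ℝ) → Matrix (Fin n) (Fin n) ℝ} {ω : (Fin n → ℝ) → (Fin n → ℝ)}
    (h : IsRandersDatum U g ω) (hU : IsOpen U) {p v : Fin n → ℝ} (hp : p ∈ U) (hv : v ≠ 0) :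
    ∃ (I : Set ℝ) (x : ℝ → Fin n → ℝ), IsRandersGeodesic U g ω I x ∧ 0 ∈ I ∧ x 0 = p ∧
      deriv x 0 = v ∧ deriv (deriv x) 0 = spray g ω p v := by
  obtain ⟨r, hr, ε, hε, α, hα, -⟩ := h.exists_spray_flow hU hp hv
  obtain ⟨h0, hα⟩ := hα (p, v) (Metric.mem_ball_self hr)
  set x : ℝ → Fin n → ℝ := fun s => (α ((p, v), s)).1 with hx
  set y : ℝ → Fin n → ℝ := fun s => (α ((p, v), s)).2 with hy
  set I := Set.Ioo (-ε) ε with hI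
  have hIo : IsOpen I := isOpen_Ioo
  have hxU : ∀ t ∈ I, x t ∈ U := fun t ht => (hα t ht).1
  have hy0 : ∀ t ∈ I, y t ≠ 0 := fun t ht => (hα t ht).2.1
  have hxd : ∀ t ∈ I, HasDerivAt x (y t) t := fun t ht => (hα t ht).2.2.1
  have hyd : ∀ t ∈ I, HasDerivAt y (spray g ω (x t) (y t)) t := fun t ht => (hα t ht).2.2.2
  have hdx : ∀ t ∈ I, deriv x t = y t := fun t ht => (hxd t ht).deriv
  have hdx' : ∀ t ∈ I, deriv x =ᶠ[nhds t] y := fun t ht => by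
    filter_upwards [hIo.mem_nhds ht] with s hs using hdx s hs
  have hddx : ∀ t ∈ I, deriv (deriv x) t = spray g ω (x t) (y t) := fun t ht => by
    rw [(hdx' t ht).deriv_eq, (hyd t ht).deriv]
  have hmem : (0 : ℝ) ∈ I := ⟨by linarith, hε⟩
  have hx0 : x 0 = p := by simp [hx, h0]
  have hy00 : y 0 = v := by simp [hy, h0]
  refine ⟨I, x, ⟨hIo, Set.ordConnected_Ioo, hxU, ?_, fun t ht => by rw [hdx t ht]; exact hy0 t ht,
    fun t ht j => ?_⟩, hmem, hx0, by rw [hdx 0 hmem, hy00], by rw [hddx 0 hmem, hx0, hy00]⟩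
  · have hy1 : ContDiffOn ℝ 1 y I := by
      rw [show (1 : WithTop ℕ∞) = 0 + 1 by norm_num, contDiffOn_succ_iff_deriv_of_isOpen hIo]
      refine ⟨fun t ht => (hyd t ht).differentiableAt.differentiableWithinAt, by simp, ?_⟩
      rw [contDiffOn_zero]
      refine ContinuousOn.congr (f := fun t => spray g ω (x t) (y t)) (fun t ht => ?_)
        fun t ht => (hyd t ht).deriv
      exact ((h.contDiffAt_spray hU (z := (x t, y t)) (hxU t ht) (hy0 t ht)).continuousAt.comp
        (f := fun s => (x s, y s))
        ((hxd t ht).continuousAt.prodMk (hyd t ht).continuousAt)).continuousWithinAt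
    rw [show (2 : WithTop ℕ∞) = 1 + 1 by norm_num, contDiffOn_succ_iff_deriv_of_isOpen hIo]
    exact ⟨fun t ht => (hxd t ht).differentiableAt.differentiableWithinAt, by simp,
      hy1.congr hdx⟩
  · have hN : 0 < y t ⬝ᵥ (g (x t) *ᵥ y t) := (h.posDef (hxU t ht)).quad_pos (hy0 t ht)
    have hs := Real.sqrt_pos.2 hN
    have hD : deriv (fun s => 1 / √(∑ k, ∑ m, g (x s) k m * deriv x s k * deriv x s m)) t = 0 := by
      have e : (fun s => 1 / √(∑ k, ∑ m, g (x s) k m * deriv x s k * deriv x s m))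
          =ᶠ[nhds t] fun s => (√(y s ⬝ᵥ (g (x s) *ᵥ y s)))⁻¹ := by
        filter_upwards [hdx' t ht] with s hs
        rw [quad_eq_sum, hs, one_div]
      rw [e.deriv_eq]
      have := ((h.hasDerivAt_quad_of_spray hU (hxU t ht) (hxd t ht) (hyd t ht)).sqrt
        hN.ne').inv hs.ne'
      rw [HasDerivAt.deriv (f := fun s => (√(y s ⬝ᵥ (g (x s) *ᵥ y s)))⁻¹) this]
      simp
    rw [hD, eulerLagrange_eq, quad_eq_sum, hddx t ht, hdx t ht]
    simp only [spray, Pi.sub_apply, Pi.neg_apply, Pi.smul_apply, smul_eq_mul]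
    field_simp
    ring

/-- The acceleration of a Randers geodesic agrees with the spray up to reparametrisation. -/
theorem IsRandersGeodesic.exists_deriv_deriv_eq {n : ℕ} {U : Set (Fin n → ℝ)}
    {g : (Fin n → ℝ) → Matrix (Fin n) (Fin n) ℝ} {ω : (Fin n → ℝ) → (Fin n → ℝ)}
    {I : Set ℝ} {x : ℝ → Fin n → ℝ} (hx : IsRandersGeodesic U g ω I x)
    (hG : ∀ p ∈ U, (g p).PosDef) {t : ℝ} (ht : t ∈ I) :
    ∃ μ : ℝ, deriv (deriv x) t = spray g ω (x t) (deriv x t) + μ • deriv x t := by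
  obtain ⟨-, -, hxU, -, hv, hEL⟩ := hx
  have hs : 0 < √(deriv x t ⬝ᵥ (g (x t) *ᵥ deriv x t)) :=
    Real.sqrt_pos.2 ((hG _ (hxU t ht)).quad_pos (hv t ht))
  refine ⟨-(√(deriv x t ⬝ᵥ (g (x t) *ᵥ deriv x t)) *
    deriv (fun s => 1 / √(∑ k, ∑ m, g (x s) k m * deriv x s k * deriv x s m)) t), ?_⟩
  ext j
  have := hEL t ht j
  rw [eulerLagrange_eq] at this
  set D := deriv (fun s => 1 / √(∑ k, ∑ m, g (x s) k m * deriv x s k * deriv x s m)) t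
  rw [quad_eq_sum] at this
  simp only [spray, Pi.sub_apply, Pi.neg_apply, Pi.smul_apply, Pi.add_apply, smul_eq_mul]
  field_simp at this
  linear_combination this

/-- Pointwise projectively related Randers data have sprays agreeing up to orientation. -/
theorem spraysAgree_of_projectivelyRelated {n : ℕ} {U : Set (Fin n → ℝ)} (hU : IsOpen U)
    {g gbar : (Fin n → ℝ) → Matrix (Fin n) (Fin n) ℝ}
    {ω ωbar : (Fin n → ℝ) → (Fin n → ℝ)}
    (h : IsRandersDatum U g ω) (hbar : IsRandersDatum U gbar ωbar)
    (hproj : ∀ (I : Set ℝ) (x : ℝ → (Fin n → ℝ)),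
      IsRandersGeodesic U g ω I x →
        IsRandersGeodesic U gbar ωbar I x ∨
        IsRandersGeodesic U gbar (fun p => -(ωbar p)) I x)
    {p : Fin n → ℝ} (hp : p ∈ U) :
    SpraysAgree (christoffel gbar p - christoffel g p) (g p) (gbar p) (dform ω p)
      (dform ωbar p) := by
  intro v hv
  obtain ⟨I, x, hx, h0, hx0, hv0, ha⟩ := h.exists_geodesic hU hp hv
  have key : ∀ ω' : (Fin n → ℝ) → (Fin n → ℝ), ∀ s : ℝ, dform ω' p = s • dform ωbar p →
      IsRandersGeodesic U gbar ω' I x → ∃ μ : ℝ,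
        (christoffel gbar p - christoffel g p) v v
          + (s * √(v ⬝ᵥ (gbar p *ᵥ v))) • lorentz (gbar p) (dform ωbar p) v
          - √(v ⬝ᵥ (g p *ᵥ v)) • lorentz (g p) (dform ω p) v = μ • v := by
    intro ω' s hs hx'
    obtain ⟨μ, hμ⟩ := hx'.exists_deriv_deriv_eq (fun q hq => hbar.posDef hq) h0
    rw [ha, hx0, hv0, spray, spray, hs] at hμ
    refine ⟨μ, ?_⟩
    have e : lorentz (gbar p) (s • dform ωbar p) v = s • lorentz (gbar p) (dform ωbar p) v := by
      simp [lorentz_apply, Matrix.smul_mulVec, Matrix.mulVec_smul]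
    rw [e] at hμ
    ext j
    have := congrFun hμ j
    simp only [Pi.sub_apply, Pi.neg_apply, Pi.smul_apply, Pi.add_apply, smul_eq_mul,
      LinearMap.sub_apply] at this ⊢
    linear_combination this
  rcases hproj I x hx with hx' | hx'
  · exact ⟨1, Or.inl rfl, key ωbar 1 (by simp) hx'⟩
  · exact ⟨-1, Or.inr rfl, key _ (-1) (by rw [dform_neg]; simp) hx'⟩

/-- Two metrics whose geodesic sprays differ by a multiple of the velocity. -/
def ProjectivelyEquivalent {n : ℕ} (U : Set (Fin n → ℝ))
    (g gbar : (Fin n → ℝ) → Matrix (Fin n) (Fin n) ℝ) : Prop :=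
  ∀ p ∈ U, ∀ v ≠ 0, ∃ c : ℝ, (christoffel gbar p - christoffel g p) v v = c • v

section Projective

variable {n : ℕ} {U : Set (Fin n → ℝ)} {g gbar : (Fin n → ℝ) → Matrix (Fin n) (Fin n) ℝ}
  {ω ωbar : (Fin n → ℝ) → (Fin n → ℝ)}

theorem ProjectivelyEquivalent.exists_factor (hP : ProjectivelyEquivalent U g gbar)
    (hU : IsOpen U) (h : IsRandersDatum U g ω) (hbar : IsRandersDatum U gbar ωbar)
    {p v : Fin n → ℝ} (hp : p ∈ U) (hv : v ≠ 0) :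
    ∃ c : ℝ, christoffel gbar p v v = christoffel g p v v + c • v ∧
      ((gbar p)⁻¹ * matDeriv gbar p v).trace - ((g p)⁻¹ * matDeriv g p v).trace = (n + 1) * c := by
  obtain ⟨c, hc⟩ := hP p hp v hv
  refine ⟨c, ?_, ?_⟩
  · rw [← hc]; simp
  · rw [← two_mul_sum_christoffel (h.isSymm hp) (h.matDeriv_isSymm hU hp),
      ← two_mul_sum_christoffel (hbar.isSymm hp) (hbar.matDeriv_isSymm hU hp), ← mul_sub,
      ← Finset.sum_sub_distrib]
    refine trace_of_forall_exists_smul (B := christoffel gbar p - christoffel g p) (fun v w => ?_)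
      (hP p hp) hv hc
    simp only [LinearMap.sub_apply]
    rw [christoffel_comm (h.matDeriv_isSymm hU hp), christoffel_comm (hbar.matDeriv_isSymm hU hp)]

theorem ProjectivelyEquivalent.exists_const_of_conformal (hP : ProjectivelyEquivalent U g gbar)
    (hn : 2 ≤ n) (hU : IsOpen U) (h : IsRandersDatum U g ω) (hbar : IsRandersDatum U gbar ωbar)
    {O : Set (Fin n → ℝ)} (hO : IsOpen O) (hOc : IsPreconnected O) (hOU : O ⊆ U)
    (hconf : ∀ p ∈ O, ∃ κ : ℝ, 0 < κ ∧ gbar p = κ • g p) (hne : O.Nonempty) :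
    ∃ κ : ℝ, 0 < κ ∧ ∀ p ∈ O, gbar p = κ • g p := by
  let i₀ : Fin n := ⟨0, by omega⟩
  set σ : (Fin n → ℝ) → ℝ := fun q => gbar q i₀ i₀ / g q i₀ i₀ with hσ
  have hpos : ∀ q ∈ U, g q i₀ i₀ ≠ 0 := fun q hq => ((h.posDef hq).diag_pos (i := i₀)).ne'
  have hσeq : ∀ q ∈ O, 0 < σ q ∧ gbar q = σ q • g q := by
    intro q hq
    obtain ⟨κ, hκ, e⟩ := hconf q hq
    have : σ q = κ := by
      simp only [hσ, e, Matrix.smul_apply, smul_eq_mul]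
      exact mul_div_cancel_right₀ _ (hpos q (hOU hq))
    rw [this]
    exact ⟨hκ, e⟩
  have hdiff : ∀ q ∈ O, DifferentiableAt ℝ σ q := by
    intro q hq
    have h1 := (hbar.contDiffAt_metric hU (hOU hq) i₀ i₀).differentiableAt two_ne_zero
    have h2 := (h.contDiffAt_metric hU (hOU hq) i₀ i₀).differentiableAt two_ne_zero
    simp only [hσ, div_eq_mul_inv]
    exact h1.mul (h2.fun_inv (hpos q (hOU hq)))
  have hfd : Set.EqOn (fderiv ℝ σ) 0 O := by
    intro q hq
    have hqU := hOU hq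
    obtain ⟨hσ0, hσq⟩ := hσeq q hq
    ext v
    by_cases hv : v = 0
    · simp [hv]
    have hmat : matDeriv gbar q v = σ q • matDeriv g q v + (fderiv ℝ σ q v) • g q := by
      ext i j
      have e : (fun y => gbar y i j) =ᶠ[nhds q] fun y => σ y * g y i j := by
        filter_upwards [hO.mem_nhds hq] with y hy
        rw [(hσeq y hy).2]; rfl
      have hd := (h.contDiffAt_metric hU hqU i j).differentiableAt two_ne_zero
      simp only [matDeriv, Matrix.of_apply, Matrix.add_apply, Matrix.smul_apply, smul_eq_mul]
      rw [e.fderiv_eq, fderiv_fun_mul (hdiff q hq) hd]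
      simp
      ring
    obtain ⟨c, hc, htr⟩ := hP.exists_factor hU h hbar hqU hv
    have hN := (h.posDef hqU).quad_pos hv
    have h1 := dotProduct_mulVec_christoffel (hbar.posDef hqU) v
    have h2 := dotProduct_mulVec_christoffel (h.posDef hqU) v
    rw [hc, hmat, hσq, Matrix.mulVec_add, dotProduct_add, Matrix.smul_mulVec, Matrix.smul_mulVec,
      Matrix.add_mulVec, Matrix.smul_mulVec, Matrix.smul_mulVec, Matrix.mulVec_smul, dotProduct_add,
      dotProduct_smul, dotProduct_smul, dotProduct_smul, dotProduct_smul, dotProduct_smul, h2] at h1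
    simp only [smul_eq_mul] at h1
    have h3 : fderiv ℝ σ q v = 2 * σ q * c := by
      apply mul_right_cancel₀ hN.ne'
      linear_combination (-2) * h1
    have hinv : (gbar q)⁻¹ = (σ q)⁻¹ • (g q)⁻¹ := by
      rw [hσq]
      refine Matrix.inv_eq_left_inv ?_
      rw [Matrix.smul_mul, Matrix.mul_smul, Matrix.nonsing_inv_mul _ (h.posDef hqU).det_pos.ne'.isUnit,
        smul_smul, inv_mul_cancel₀ hσ0.ne', one_smul]
    rw [hinv, hmat, Matrix.smul_mul, Matrix.mul_add, Matrix.mul_smul, Matrix.mul_smul,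
      Matrix.nonsing_inv_mul _ (h.posDef hqU).det_pos.ne'.isUnit, Matrix.trace_smul,
      Matrix.trace_add, Matrix.trace_smul, Matrix.trace_smul, Matrix.trace_one, Fintype.card_fin,
      h3] at htr
    simp only [smul_eq_mul] at htr
    have hc0 : c = 0 := by
      have hn' : (2 : ℝ) ≤ n := by exact_mod_cast hn
      field_simp at htr
      have : ((n : ℝ) - 1) * c = 0 := by linear_combination htr
      rcases mul_eq_zero.1 this with h' | h'
      · linarith
      · exact h'
    simp [h3, hc0]
  obtain ⟨κ, hκ⟩ := hO.exists_is_const_of_fderiv_eq_zero hOc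
    (fun q hq => (hdiff q hq).differentiableWithinAt) hfd
  obtain ⟨q, hq⟩ := hne
  refine ⟨κ, ?_, fun p hp => ?_⟩
  · rw [← hκ q hq]; exact (hσeq q hq).1
  · rw [← hκ p hp]; exact (hσeq p hp).2

end Projective

/-- In a connected open set, a proper open nonempty subset contains a ball touching a point outside
of it. -/
theorem exists_ball_subset_touching {E : Type*} [NormedAddCommGroup E] [NormedSpace ℝ E]
    [FiniteDimensional ℝ E] {U W : Set E} (hU : IsOpen U) (hUc : IsPreconnected U)
    (hW : IsOpen W) (hne : (U ∩ W).Nonempty) (hWU : ¬ U ⊆ W) :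
    ∃ p ∈ U, p ∉ W ∧ ∃ q, q ≠ p ∧ Metric.ball q (dist q p) ⊆ W := by
  have := FiniteDimensional.proper ℝ E
  have hcl : ¬ closure W ∩ U ⊆ W := fun hcl =>
    hWU (hUc.subset_of_closure_inter_subset hW hne hcl)
  obtain ⟨p₀, ⟨hp₀, hp₀U⟩, hp₀W⟩ := Set.not_subset.1 hcl
  obtain ⟨r, hr, hrU⟩ := Metric.isOpen_iff.1 hU p₀ hp₀U
  obtain ⟨q, hqW, hq⟩ := Metric.mem_closure_iff.1 hp₀ (r / 2) (half_pos hr)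
  obtain ⟨p, hp, hpd⟩ := hW.isClosed_compl.exists_infDist_eq_dist ⟨p₀, hp₀W⟩ q
  have hd : dist q p ≤ dist q p₀ := hpd ▸ Metric.infDist_le_dist_of_mem hp₀W
  refine ⟨p, hrU ?_, hp, q, fun e => hp (e ▸ hqW), ?_⟩
  · have h1 := dist_triangle p q p₀
    rw [dist_comm p q, dist_comm q p₀] at h1
    rw [dist_comm q p₀] at hd
    rw [Metric.mem_ball]
    linarith
  · rw [← hpd]
    exact Metric.ball_infDist_compl_subset

/-- A curve leaving `p` with velocity `q - p` immediately enters the open ball around `q`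
through `p`. -/
theorem eventually_mem_ball_of_hasDerivAt {E : Type*} [NormedAddCommGroup E] [NormedSpace ℝ E]
    {x : ℝ → E} {p q : E} (hx : HasDerivAt x (q - p) 0) (hx0 : x 0 = p) (hqp : q ≠ p) :
    ∀ᶠ t in nhdsWithin (0 : ℝ) (Set.Ioi 0), x t ∈ Metric.ball q (dist q p) := by
  have hρ : 0 < ‖q - p‖ := norm_pos_iff.2 (sub_ne_zero.2 hqp)
  have h1 := (hasDerivAt_iff_isLittleO.1 hx).def (half_pos hρ)
  have h2 : ∀ᶠ t : ℝ in nhds 0, t < 1 := eventually_lt_nhds one_pos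
  filter_upwards [h1.filter_mono nhdsWithin_le_nhds, h2.filter_mono nhdsWithin_le_nhds,
    self_mem_nhdsWithin] with t ht ht1 ht0
  rw [sub_zero, hx0, Real.norm_of_nonneg (le_of_lt ht0)] at ht
  rw [Metric.mem_ball, dist_eq_norm, dist_eq_norm]
  have e : x t - q = (x t - p - t • (q - p)) + (-(1 - t)) • (q - p) := by
    simp only [sub_smul, neg_smul, one_smul]; abel
  have ht0' : 0 < t := ht0
  calc ‖x t - q‖ ≤ ‖x t - p - t • (q - p)‖ + ‖(-(1 - t)) • (q - p)‖ := by
        rw [e]; exact norm_add_le _ _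
    _ ≤ ‖q - p‖ / 2 * t + (1 - t) * ‖q - p‖ := by
        rw [norm_smul, norm_neg, Real.norm_of_nonneg (by linarith)]
        linarith
    _ < ‖q - p‖ := by nlinarith

/-- A symmetric matrix is determined by its quadratic form on a nonempty open set. -/
theorem Matrix.IsSymm.eq_of_quad_eq_on {n : ℕ} {G H : Matrix (Fin n) (Fin n) ℝ}
    (hG : G.IsSymm) (hH : H.IsSymm) {V : Set (Fin n → ℝ)} {v₀ : Fin n → ℝ} (hV : V ∈ nhds v₀)
    (h : ∀ v ∈ V, v ⬝ᵥ (G *ᵥ v) = v ⬝ᵥ (H *ᵥ v)) : G = H := by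
  refine hG.eq_of_quad_eq hH fun w => ?_
  have hc : Filter.Tendsto (fun s : ℝ => v₀ + s • w) (nhds 0) (nhds v₀) := by
    have : Continuous fun s : ℝ => v₀ + s • w := by fun_prop
    simpa using this.tendsto 0
  have hc' : Filter.Tendsto (fun s : ℝ => v₀ + (-s) • w) (nhds 0) (nhds v₀) := by
    have : Continuous fun s : ℝ => v₀ + (-s) • w := by fun_prop
    simpa using this.tendsto 0
  have hev : ∀ᶠ s in nhds (0 : ℝ), v₀ + s • w ∈ V ∧ v₀ + (-s) • w ∈ V :=
    (hc.eventually_mem hV).and (hc'.eventually_mem hV)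
  obtain ⟨s, ⟨hs1, hs2⟩, hs0⟩ := ((hev.filter_mono nhdsWithin_le_nhds).and
    (self_mem_nhdsWithin (a := (0 : ℝ)) (s := Set.Ioi 0))).exists
  have h0 := h v₀ (mem_of_mem_nhds hV)
  have h1 := h _ hs1
  have h2 := h _ hs2
  simp only [Matrix.mulVec_add, dotProduct_add, add_dotProduct, Matrix.mulVec_smul,
    dotProduct_smul, smul_dotProduct, smul_eq_mul] at h1 h2
  have hs : (s : ℝ) ^ 2 ≠ 0 := pow_ne_zero _ (ne_of_gt hs0)
  apply mul_left_cancel₀ hs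
  linear_combination h1 / 2 + h2 / 2 - h0

/-- The logarithm of the first integral of the geodesic flow attached to a projectively equivalent
metric. -/
noncomputable def projIntegral {n : ℕ} (g gbar : (Fin n → ℝ) → Matrix (Fin n) (Fin n) ℝ)
    (p v : Fin n → ℝ) : ℝ :=
  (n + 1) * (Real.log (v ⬝ᵥ (gbar p *ᵥ v)) - Real.log (v ⬝ᵥ (g p *ᵥ v)))
    - 2 * (Real.log (gbar p).det - Real.log (g p).det)

section Projective

variable {n : ℕ} {U : Set (Fin n → ℝ)} {g gbar : (Fin n → ℝ) → Matrix (Fin n) (Fin n) ℝ}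
  {ω ωbar : (Fin n → ℝ) → (Fin n → ℝ)}

theorem projIntegral_of_eq_smul {p v : Fin n → ℝ} (hG : (g p).PosDef) {κ : ℝ} (hκ : 0 < κ)
    (hv : v ≠ 0) (e : gbar p = κ • g p) : projIntegral g gbar p v = (1 - n) * Real.log κ := by
  rw [projIntegral, e, Matrix.smul_mulVec, dotProduct_smul, smul_eq_mul, Matrix.det_smul,
    Real.log_mul hκ.ne' (hG.quad_pos hv).ne',
    Real.log_mul (pow_ne_zero _ hκ.ne') hG.det_pos.ne', Real.log_pow, Fintype.card_fin]
  ring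

theorem eq_smul_of_projIntegral_eq (hn : 2 ≤ n) {p v₀ : Fin n → ℝ} (hG : (g p).PosDef)
    (hGs : (g p).IsSymm) (hH : (gbar p).PosDef) (hHs : (gbar p).IsSymm) {κ : ℝ} (hκ : 0 < κ)
    (hv₀ : v₀ ≠ 0) {V : Set (Fin n → ℝ)} (hV : V ∈ nhds v₀)
    (h : ∀ v ∈ V, projIntegral g gbar p v = (1 - n) * Real.log κ) : gbar p = κ • g p := by
  set f := (v₀ ⬝ᵥ (gbar p *ᵥ v₀)) / (v₀ ⬝ᵥ (g p *ᵥ v₀)) with hf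
  have hg0 := hG.quad_pos hv₀
  have hh0 := hH.quad_pos hv₀
  have hf0 : 0 < f := div_pos hh0 hg0
  have hn1 : (n : ℝ) + 1 ≠ 0 := by positivity
  have h0 := h v₀ (mem_of_mem_nhds hV)
  have e : gbar p = f • g p := by
    refine hHs.eq_of_quad_eq_on (hGs.smul f) hV fun v hv => ?_
    by_cases hv0 : v = 0
    · simp [hv0]
    have h1 := h v hv
    have hg1 := hG.quad_pos hv0
    have hh1 := hH.quad_pos hv0
    rw [projIntegral] at h0 h1
    have : Real.log (v ⬝ᵥ (gbar p *ᵥ v)) = Real.log (f * (v ⬝ᵥ (g p *ᵥ v))) := by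
      rw [Real.log_mul hf0.ne' hg1.ne', hf, Real.log_div hh0.ne' hg0.ne']
      apply mul_left_cancel₀ hn1
      linear_combination h1 - h0
    rw [Matrix.smul_mulVec, dotProduct_smul, smul_eq_mul]
    exact Real.log_injOn_pos hh1 (mul_pos hf0 hg1) this
  rw [projIntegral_of_eq_smul hG hf0 hv₀ e] at h0
  have hn' : (1 - n : ℝ) ≠ 0 := by
    have : (2 : ℝ) ≤ n := by exact_mod_cast hn
    linarith
  rw [e, Real.log_injOn_pos hf0 hκ (mul_left_cancel₀ hn' h0)]

theorem ProjectivelyEquivalent.hasDerivAt_projIntegral (hP : ProjectivelyEquivalent U g gbar)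
    (hU : IsOpen U) (h : IsRandersDatum U g ω) (hbar : IsRandersDatum U gbar ωbar)
    {x v : ℝ → Fin n → ℝ} {t : ℝ} (ht : x t ∈ U) (hv0 : v t ≠ 0)
    (hx : HasDerivAt x (v t) t)
    (hv : HasDerivAt v (spray g (fun _ => 0) (x t) (v t)) t) :
    HasDerivAt (fun s => projIntegral g gbar (x s) (v s)) 0 t := by
  have hN := (h.posDef ht).quad_pos hv0
  have hN' := (hbar.posDef ht).quad_pos hv0
  obtain ⟨c, hc, htr⟩ := hP.exists_factor hU h hbar ht hv0
  have h1 := h.zero_form.hasDerivAt_quad_of_spray hU ht hx hv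
  have h2 := hbar.hasDerivAt_quad hU hx hv ht
  have e : spray g (fun _ => 0) (x t) (v t)
      = c • v t - christoffel gbar (x t) (v t) (v t) := by
    rw [hc, spray, dform_zero, lorentz_apply]
    simp
  have h3 : 2 * (v t ⬝ᵥ (gbar (x t) *ᵥ spray g (fun _ => 0) (x t) (v t)))
      + v t ⬝ᵥ (matDeriv gbar (x t) (v t) *ᵥ v t)
      = 2 * c * (v t ⬝ᵥ (gbar (x t) *ᵥ v t)) := by
    rw [e, Matrix.mulVec_sub, dotProduct_sub, Matrix.mulVec_smul, dotProduct_smul, smul_eq_mul,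
      dotProduct_mulVec_christoffel (hbar.posDef ht)]
    ring
  rw [h3] at h2
  refine ((((h2.log hN'.ne').sub (h1.log hN.ne')).const_mul ((n : ℝ) + 1)).sub
    (((hbar.hasDerivAt_log_det hU hx ht).sub (h.hasDerivAt_log_det hU hx ht)).const_mul
      2)).congr_deriv ?_
  rw [htr, mul_div_cancel_right₀ _ hN'.ne']
  ring

/-- The homothety relation extends across boundary points of balls. -/
theorem ProjectivelyEquivalent.eventually_eq_smul (hP : ProjectivelyEquivalent U g gbar)
    (hn : 2 ≤ n) (hU : IsOpen U) (h : IsRandersDatum U g ω) (hbar : IsRandersDatum U gbar ωbar)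
    {κ : ℝ} (hκ : 0 < κ) {p q : Fin n → ℝ} (hp : p ∈ U) (hqp : q ≠ p)
    (hball : ∀ y ∈ Metric.ball q (dist q p), gbar y = κ • g y) :
    ∀ᶠ y in nhds p, gbar y = κ • g y := by
  obtain ⟨r, hr, ε, hε, α, hα, hαc⟩ :=
    h.zero_form.exists_spray_flow hU hp (v := q - p) (sub_ne_zero.2 hqp)
  have hmem0 : (0 : ℝ) ∈ Set.Ioo (-ε) ε := ⟨by linarith, hε⟩
  have hz₀ := Metric.mem_ball_self (x := (p, q - p)) hr
  obtain ⟨h00, h01⟩ := hα _ hz₀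
  have hev := eventually_mem_ball_of_hasDerivAt (x := fun s => (α ((p, q - p), s)).1) (p := p)
    (q := q) (by simpa [h00] using (h01 0 hmem0).2.2.1) (by simp [h00]) hqp
  obtain ⟨t, ht, htε⟩ := (hev.and ((Ioo_mem_nhds hmem0.1 hmem0.2 |> fun hh =>
    (Filter.eventually_iff.2 hh : ∀ᶠ s in nhds (0 : ℝ), s ∈ Set.Ioo (-ε) ε)).filter_mono
      nhdsWithin_le_nhds)).exists
  have hcont : ContinuousAt (fun z => (α (z, t)).1) (p, q - p) := by
    have := hαc.continuousAt (prod_mem_nhds (Metric.ball_mem_nhds (p, q - p) hr)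
      (Ioo_mem_nhds htε.1 htε.2))
    exact continuousAt_fst.comp (this.comp (f := fun z => (z, t)) (by fun_prop))
  have hev2 : ∀ᶠ z in nhds (p, q - p), projIntegral g gbar z.1 z.2 = (1 - n) * Real.log κ := by
    filter_upwards [hcont (Metric.isOpen_ball.mem_nhds ht), Metric.ball_mem_nhds (p, q - p) hr]
      with z hz hzr
    obtain ⟨hz0, hz1⟩ := hα z hzr
    have hd : ∀ s ∈ Set.Ioo (-ε) ε, HasDerivAt
        (fun s => projIntegral g gbar (α (z, s)).1 (α (z, s)).2) 0 s := fun s hs =>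
      hP.hasDerivAt_projIntegral hU h hbar (x := fun s => (α (z, s)).1)
        (v := fun s => (α (z, s)).2) (hz1 s hs).1 (hz1 s hs).2.1 (hz1 s hs).2.2.1
        (hz1 s hs).2.2.2
    have hconst := isOpen_Ioo.is_const_of_deriv_eq_zero isPreconnected_Ioo
      (fun s hs => (hd s hs).differentiableAt.differentiableWithinAt)
      (fun s hs => (hd s hs).deriv) hmem0 htε
    simp only [hz0] at hconst
    rw [hconst]
    exact projIntegral_of_eq_smul (h.posDef (hz1 t htε).1) hκ (hz1 t htε).2.1 (hball _ hz)
  obtain ⟨A, hA, B, hB, hAB⟩ := mem_nhds_prod_iff.1 hev2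
  filter_upwards [hA, hU.mem_nhds hp] with y hy hyU
  exact eq_smul_of_projIntegral_eq hn (h.posDef hyU) (h.isSymm hyU) (hbar.posDef hyU)
    (hbar.isSymm hyU) hκ (sub_ne_zero.2 hqp) hB fun v hv => hAB (Set.mk_mem_prod hy hv)

theorem ProjectivelyEquivalent.eqOn_of_eqOn_isOpen (hP : ProjectivelyEquivalent U g gbar)
    (hn : 2 ≤ n) (hU : IsOpen U) (hUc : IsPreconnected U) (h : IsRandersDatum U g ω)
    (hbar : IsRandersDatum U gbar ωbar) {κ : ℝ} (hκ : 0 < κ) {O : Set (Fin n → ℝ)}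
    (hO : IsOpen O) (hOU : O ⊆ U) (hne : O.Nonempty) (hOe : ∀ p ∈ O, gbar p = κ • g p) :
    ∀ p ∈ U, gbar p = κ • g p := by
  set S : Set (Fin n → ℝ) := {p | gbar p = κ • g p} with hS
  set W := interior S with hW
  have hWS : W ⊆ S := interior_subset
  have hOW : O ⊆ W := hO.subset_interior_iff.2 hOe
  have hUW : U ⊆ W := by
    by_contra hcon
    obtain ⟨q₀, hq₀⟩ := hne
    obtain ⟨p, hp, hpW, q, hqp, hball⟩ := exists_ball_subset_touching hU hUc isOpen_interior
      ⟨q₀, hOU hq₀, hOW hq₀⟩ hcon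
    exact hpW (mem_interior_iff_mem_nhds.2
      (hP.eventually_eq_smul hn hU h hbar hκ hp hqp fun y hy => hWS (hball hy)))
  exact fun p hp => hWS (hUW hp)

end Projective

theorem IsRandersDatum.continuousOn_dform {n : ℕ} {U : Set (Fin n → ℝ)}
    {g : (Fin n → ℝ) → Matrix (Fin n) (Fin n) ℝ} {ω : (Fin n → ℝ) → (Fin n → ℝ)}
    (h : IsRandersDatum U g ω) (hU : IsOpen U) : ContinuousOn (dform ω) U := fun _ hp =>
  ContinuousAt.continuousWithinAt (continuousAt_pi.2 fun i => continuousAt_pi.2 fun j =>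
    (h.contDiffAt_dform hU hp i j).continuousAt)

/-- On a preconnected set where `dω` does not vanish, the sign in `dω̄ = ± c dω` is constant. -/
theorem dform_eq_or_eq_neg_of_isPreconnected {n : ℕ} {U : Set (Fin n → ℝ)} (hU : IsOpen U)
    {g gbar : (Fin n → ℝ) → Matrix (Fin n) (Fin n) ℝ} {ω ωbar : (Fin n → ℝ) → (Fin n → ℝ)}
    (h : IsRandersDatum U g ω) (hbar : IsRandersDatum U gbar ωbar) {c : ℝ} (hc : 0 < c)
    {O : Set (Fin n → ℝ)} (hOU : O ⊆ U) (hO : IsPreconnected O) (hne : ∀ p ∈ O, dform ω p ≠ 0)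
    (hor : ∀ p ∈ O, dform ωbar p = c • dform ω p ∨ dform ωbar p = -(c • dform ω p)) :
    (∀ p ∈ O, dform ωbar p = c • dform ω p) ∨ ∀ p ∈ O, dform ωbar p = -(c • dform ω p) := by
  have hcont : ∀ {g : (Fin n → ℝ) → Matrix (Fin n) (Fin n) ℝ} {ω : (Fin n → ℝ) → (Fin n → ℝ)},
      IsRandersDatum U g ω → ∀ i j, ContinuousOn (fun p => dform ω p i j) O := fun h i j =>
    continuousOn_pi.1 (continuousOn_pi.1 ((h.continuousOn_dform hU).mono hOU) i) j
  set F : (Fin n → ℝ) → ℝ := fun p => ∑ i, ∑ j, dform ωbar p i j * dform ω p i j with hF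
  set G : (Fin n → ℝ) → ℝ := fun p => c * ∑ i, ∑ j, dform ω p i j * dform ω p i j with hG
  have hFc : ContinuousOn F O := continuousOn_finsetSum _ fun i _ =>
    continuousOn_finsetSum _ fun j _ => (hcont hbar i j).mul (hcont h i j)
  have hGc : ContinuousOn G O := (continuousOn_finsetSum _ fun i _ =>
    continuousOn_finsetSum _ fun j _ => (hcont h i j).mul (hcont h i j)).const_mul c
  have hG0 : ∀ {p}, p ∈ O → 0 < G p := by
    intro p hp
    refine mul_pos hc (lt_of_le_of_ne (Finset.sum_nonneg fun i _ => Finset.sum_nonneg fun j _ =>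
      mul_self_nonneg _) fun e => hne p hp ?_)
    ext i j
    have h1 := (Finset.sum_eq_zero_iff_of_nonneg fun i _ => Finset.sum_nonneg fun j _ =>
      mul_self_nonneg (dform ω p i j)).1 e.symm i (Finset.mem_univ _)
    exact mul_self_eq_zero.1 ((Finset.sum_eq_zero_iff_of_nonneg fun j _ =>
      mul_self_nonneg (dform ω p i j)).1 h1 j (Finset.mem_univ _))
  have hpos : ∀ {p}, dform ωbar p = c • dform ω p → F p = G p := by
    intro p e
    simp only [hF, hG, e, Finset.mul_sum]
    exact Finset.sum_congr rfl fun i _ => Finset.sum_congr rfl fun j _ => by simp; ring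
  have hneg : ∀ {p}, dform ωbar p = -(c • dform ω p) → F p = -G p := by
    intro p e
    simp only [hF, hG, e, Finset.mul_sum, ← Finset.sum_neg_distrib]
    exact Finset.sum_congr rfl fun i _ => Finset.sum_congr rfl fun j _ => by simp; ring
  rcases hO.eq_or_eq_neg_of_sq_eq hFc hGc (fun p hp => by
    rcases hor p hp with e | e
    · simp [hpos e]
    · simp [hneg e]) (fun {p} hp => (hG0 hp).ne') with H | H
  · refine Or.inl fun p hp => (hor p hp).resolve_right fun e => ?_
    have h1 := H hp
    rw [hneg e] at h1
    linarith [hG0 hp]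
  · refine Or.inr fun p hp => (hor p hp).resolve_left fun e => ?_
    have h1 := H hp
    rw [hpos e, Pi.neg_apply] at h1
    linarith [hG0 hp]

theorem dform_sub_smul {n : ℕ} {ω ωbar : (Fin n → ℝ) → (Fin n → ℝ)} {p : Fin n → ℝ}
    (h : ∀ i, DifferentiableAt ℝ (fun q => ω q i) p)
    (hbar : ∀ i, DifferentiableAt ℝ (fun q => ωbar q i) p) (c : ℝ) :
    dform (fun q => ωbar q - c • ω q) p = dform ωbar p - c • dform ω p := by
  have e : ∀ i, fderiv ℝ (fun q => (ωbar q - c • ω q) i) p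
      = fderiv ℝ (fun q => ωbar q i) p - c • fderiv ℝ (fun q => ω q i) p := by
    intro i
    simp only [Pi.sub_apply, Pi.smul_apply, smul_eq_mul]
    rw [fderiv_fun_sub (hbar i) ((h i).const_mul c), fderiv_const_mul (h i)]
  ext i j
  simp only [dform, dpart, Matrix.of_apply, e, Matrix.sub_apply, Matrix.smul_apply, smul_eq_mul]
  simp
  ring

/-- Corollary 4 of the paper: if two Randers data on a connected open set are pointwise
projectively related and the set where `dω ≠ 0` is nonempty and connected, then for some
constant `c > 0` either `ḡ = c²·g` and `ω̄ − c·ω` is closed, or `ḡ = c²·g` and `ω̄ + c·ω`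
is closed, on all of `U`. -/
theorem stmt_13 (n : ℕ) (hn : 2 ≤ n) (U : Set (Fin n → ℝ))
    (hUopen : IsOpen U) (hUconn : IsConnected U)
    (g gbar : (Fin n → ℝ) → Matrix (Fin n) (Fin n) ℝ)
    (ω ωbar : (Fin n → ℝ) → (Fin n → ℝ))
    (hdatum : IsRandersDatum U g ω) (hdatumbar : IsRandersDatum U gbar ωbar)
    (hproj : ∀ (I : Set ℝ) (x : ℝ → (Fin n → ℝ)),
      IsRandersGeodesic U g ω I x →
        IsRandersGeodesic U gbar ωbar I x ∨
        IsRandersGeodesic U gbar (fun p => -(ωbar p)) I x)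
    (hU0conn : IsConnected {p | p ∈ U ∧ dform ω p ≠ 0}) :
    ∃ c : ℝ, 0 < c ∧
      (((∀ p ∈ U, gbar p = (c ^ 2) • g p) ∧
          IsClosedFormOn U (fun p => ωbar p - c • ω p)) ∨
       ((∀ p ∈ U, gbar p = (c ^ 2) • g p) ∧
          IsClosedFormOn U (fun p => ωbar p + c • ω p))) := by
  set O : Set (Fin n → ℝ) := {p | p ∈ U ∧ dform ω p ≠ 0} with hO
  have hOU : O ⊆ U := fun p hp => hp.1
  have hOo : IsOpen O :=
    (hdatum.continuousOn_dform hUopen).isOpen_inter_preimage hUopen isOpen_compl_singleton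
  have hS := fun {p} (hp : p ∈ U) => spraysAgree_of_projectivelyRelated hUopen hdatum hdatumbar
    hproj hp
  have hP : ProjectivelyEquivalent U g gbar := fun p hp v hv =>
    (hS hp).exists_smul hn (hdatum.posDef hp) (hdatumbar.posDef hp) (dform_transpose ω p)
      (dform_transpose ωbar p) hv
  obtain ⟨κ, hκ, hOκ⟩ := hP.exists_const_of_conformal hn hUopen hdatum hdatumbar hOo
    hU0conn.isPreconnected hOU (fun p hp => (hS hp.1).exists_conformal hn (hdatum.posDef hp.1)
      (hdatumbar.posDef hp.1) (hdatum.isSymm hp.1) (hdatumbar.isSymm hp.1) (dform_transpose ω p)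
      (dform_transpose ωbar p) hp.2) hU0conn.nonempty
  have hUκ := hP.eqOn_of_eqOn_isOpen hn hUopen hUconn.isPreconnected hdatum hdatumbar hκ hOo hOU
    hU0conn.nonempty hOκ
  have hc : 0 < √κ := Real.sqrt_pos.2 hκ
  have hUc : ∀ p ∈ U, gbar p = (√κ ^ 2) • g p := by rwa [Real.sq_sqrt hκ.le]
  have hoff : ∀ p ∈ U, p ∉ O → dform ω p = 0 ∧ dform ωbar p = 0 := by
    intro p hp hpO
    have h0 : dform ω p = 0 := by
      by_contra hne
      exact hpO ⟨hp, hne⟩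
    have hSp := hS hp
    rw [h0] at hSp
    exact ⟨h0, (hSp.of_form_eq_zero hn (hdatumbar.posDef hp) (dform_transpose ωbar p)).2⟩
  have hd : ∀ p ∈ U, ∀ i, DifferentiableAt ℝ (fun q => ω q i) p := fun p hp i =>
    (hdatum.contDiffAt_form hUopen hp i).differentiableAt two_ne_zero
  have hdbar : ∀ p ∈ U, ∀ i, DifferentiableAt ℝ (fun q => ωbar q i) p := fun p hp i =>
    (hdatumbar.contDiffAt_form hUopen hp i).differentiableAt two_ne_zero
  refine ⟨√κ, hc, ?_⟩
  rcases dform_eq_or_eq_neg_of_isPreconnected hUopen hdatum hdatumbar hc hOU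
    hU0conn.isPreconnected (fun p hp => hp.2) (fun p hp => by
      have hSp := hS hp.1
      rw [hUc p hp.1] at hSp
      exact hSp.form_eq_or_neg hc hn (hdatum.posDef hp.1) (dform_transpose ω p)
        (dform_transpose ωbar p)) with H | H
  · refine Or.inl ⟨hUc, fun p hp => ?_⟩
    rw [dform_sub_smul (hd p hp) (hdbar p hp)]
    by_cases hpO : p ∈ O
    · rw [H p hpO, sub_self]
    · simp [hoff p hp hpO]
  · refine Or.inr ⟨hUc, fun p hp => ?_⟩
    have e : (fun q => ωbar q + √κ • ω q) = fun q => ωbar q - (-√κ) • ω q := by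
      ext q i; simp
    rw [e, dform_sub_smul (hd p hp) (hdbar p hp)]
    by_cases hpO : p ∈ O
    · rw [H p hpO]; simp
    · simp [hoff p hp hpO]
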